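/- arXiv:math/0404079 — 5 statements merged into one kernel-verified Lean document; each statement's English description precedes it below -/
import Mathlib

section
/- For every integer n ≥ 4, the number of partitions λ = (λ_1 ≥ ... ≥ λ_n ≥ 0) with n parts and |λ| = d for which there exists an index i with λ_i = λ_{i+1}, λ_{i−1} − λ_i ≥ 1 if i ≥ 2, and λ_j − λ_{j+1} ≥ 2 for all j with j ≤ i−2 or i+1 ≤ j ≤ n−1, satisfies the generating function identity Σ_{d=0}^∞ #{such λ} q^d = (q^{(n-2)²}/(q)_n) · Σ_{i=0}^{n-2} q^{3i}(1−q^{n-1-i}), as formal power series in q, where (q)_n = ∏_{j=1}^n (1 − q^j) and division means multiplication by the inverse of this unit in the formal power series ring. -/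
open Finset

/-- A partition with `n` (possibly zero) parts, encoded as a weakly decreasing function
`ℕ → ℕ` (0-indexed: `l 0, …, l (n-1)` are the parts `λ_1, …, λ_n`) vanishing from index `n` on. -/
def PartitionN (n : ℕ) (l : ℕ → ℕ) : Prop :=
  Antitone l ∧ ∀ j, n ≤ j → l j = 0

/-- `(q)_s = ∏_{j=1}^s (1 - q^j)` as a formal power series over `ℚ`. -/
noncomputable def qPoch (s : ℕ) : PowerSeries ℚ :=
  ∏ j ∈ Finset.range s, (1 - (PowerSeries.X : PowerSeries ℚ) ^ (j + 1))

/-- Case-3 condition (0-based index `i`): `λ_i = λ_{i+1}`, `λ_{i-1} - λ_i ≥ 1` if `i ≥ 1`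
(0-based), and `λ_j - λ_{j+1} ≥ 2` for `j ≤ i-2` or `j ≥ i+1` (0-based). -/
def Case3 (n : ℕ) (l : ℕ → ℕ) : Prop :=
  ∃ i : ℕ, i + 2 ≤ n ∧ l i = l (i + 1) ∧
    (1 ≤ i → l i + 1 ≤ l (i - 1)) ∧
    (∀ j, j + 1 < n → (j + 2 ≤ i ∨ i + 1 ≤ j) → l (j + 1) + 2 ≤ l j)

theorem sum_eq_sum_mul_diff {l : ℕ → ℕ} (hl : Antitone l) (m : ℕ) :
    ∑ j ∈ range m, l j = ∑ j ∈ range m, (j + 1) * (l j - l (j + 1)) + m * l m := by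
  induction m with
  | zero => simp
  | succ m ih =>
    rw [sum_range_succ, sum_range_succ, ih]
    obtain ⟨t, ht⟩ := Nat.exists_eq_add_of_le (hl (Nat.le_succ m))
    rw [Nat.succ_eq_add_one] at ht
    rw [ht, Nat.add_sub_cancel_left]
    ring

theorem sum_Ico_diff {l : ℕ → ℕ} (hl : Antitone l) {j n : ℕ} (h : j ≤ n) :
    ∑ k ∈ Ico j n, (l k - l (k + 1)) + l n = l j := by
  induction n, h using Nat.le_induction with
  | base => simp
  | succ n h ih =>
    rw [sum_Ico_succ_top h]
    have := hl (Nat.le_succ n)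
    grind

/-- The sequence whose `k`-th consecutive difference is `f k / (k + 1)` for `k < n`, and which
vanishes from index `n` on. -/
def ofGaps (n : ℕ) (f : ℕ → ℕ) (j : ℕ) : ℕ :=
  ∑ k ∈ Ico j n, f k / (k + 1)

theorem partitionN_ofGaps (n : ℕ) (f : ℕ → ℕ) : PartitionN n (ofGaps n f) := by
  refine ⟨fun a b hab => ?_, fun j hj => ?_⟩
  · exact sum_le_sum_of_subset (Ico_subset_Ico_left hab)
  · simp [ofGaps, Ico_eq_empty_of_le hj]

theorem ofGaps_sub {n j : ℕ} (f : ℕ → ℕ) (hj : j < n) :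
    ofGaps n f j - ofGaps n f (j + 1) = f j / (j + 1) := by
  simp only [ofGaps]
  rw [sum_eq_sum_Ico_succ_bot hj, Nat.add_sub_cancel]

/-- Partitions of `d` into `n` parts whose `j`-th consecutive difference lies in `S j`. -/
def gapPartitions (n d : ℕ) (S : ℕ → Set ℕ) : Set (ℕ → ℕ) :=
  {l | PartitionN n l ∧ ∑ j ∈ range n, l j = d ∧ ∀ j < n, l j - l (j + 1) ∈ S j}

open Classical in
/-- The finitely supported functions `f` on `range n` with sum `d` for which every `f j` is
`j + 1` times an element of `S j`. -/
noncomputable def gapFinset (n d : ℕ) (S : ℕ → Set ℕ) : Finset (ℕ →₀ ℕ) :=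
  (finsuppAntidiag (range n) d).filter fun f => ∀ j ∈ range n, j + 1 ∣ f j ∧ f j / (j + 1) ∈ S j

theorem bijOn_ofGaps (n d : ℕ) (S : ℕ → Set ℕ) :
    Set.BijOn (fun f : ℕ →₀ ℕ => ofGaps n f) (gapFinset n d S) (gapPartitions n d S) := by
  refine ⟨fun f hf => ?_, fun f hf g hg hfg => ?_, fun l hl => ?_⟩
  · simp only [gapFinset, coe_filter, mem_finsuppAntidiag, Set.mem_ofPred_eq, mem_range] at hf
    obtain ⟨⟨hsum, -⟩, hf⟩ := hf
    have hp := partitionN_ofGaps n f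
    refine ⟨hp, ?_, fun j hj => ?_⟩
    · rw [sum_eq_sum_mul_diff hp.1, hp.2 n le_rfl, mul_zero, add_zero, ← hsum]
      refine sum_congr rfl fun j hj => ?_
      rw [mem_range] at hj
      rw [ofGaps_sub _ hj, Nat.mul_div_cancel' (hf j hj).1]
    · rw [ofGaps_sub _ hj]
      exact (hf j hj).2
  · simp only [gapFinset, coe_filter, mem_finsuppAntidiag, Set.mem_ofPred_eq, mem_range] at hf hg
    ext j
    by_cases hj : j < n
    · rw [← Nat.mul_div_cancel' (hf.2 j hj).1, ← Nat.mul_div_cancel' (hg.2 j hj).1,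
        ← ofGaps_sub _ hj, ← ofGaps_sub _ hj]
      simp only at hfg
      rw [hfg]
    · rw [Finsupp.notMem_support_iff.1 fun h => hj (mem_range.1 (hf.1.2 h)),
        Finsupp.notMem_support_iff.1 fun h => hj (mem_range.1 (hg.1.2 h))]
  · obtain ⟨hp, hsum, hS⟩ := hl
    have hz : l n = 0 := hp.2 n le_rfl
    refine ⟨Finsupp.onFinset (range n) (fun j => (j + 1) * (l j - l (j + 1))) fun j hj => ?_,
      ?_, ?_⟩
    · by_contra h
      rw [mem_range, not_lt] at h
      exact hj (by simp [hp.2 j h])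
    · simp only [gapFinset, coe_filter, mem_finsuppAntidiag, Set.mem_ofPred_eq, mem_range,
        Finsupp.onFinset_apply]
      refine ⟨⟨?_, Finsupp.support_onFinset_subset⟩, fun j hj => ⟨dvd_mul_right _ _, ?_⟩⟩
      · rw [← hsum, sum_eq_sum_mul_diff hp.1 n, hz, mul_zero, add_zero]
        rfl
      · rw [Nat.mul_div_cancel_left _ (Nat.succ_pos j)]
        exact hS j hj
    · funext j
      simp only [ofGaps, Finsupp.onFinset_apply, Nat.mul_div_cancel_left _ (Nat.succ_pos _)]
      rcases le_total j n with h | h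
      · rw [← sum_Ico_diff hp.1 h, hz, add_zero]
      · rw [Ico_eq_empty_of_le h, sum_empty, hp.2 j h]

theorem finite_gapPartitions (n d : ℕ) (S : ℕ → Set ℕ) : (gapPartitions n d S).Finite :=
  (bijOn_ofGaps n d S).image_eq ▸ (finite_toSet _).image _

open Classical in
/-- The generating function of the multiples of `c` by elements of `T`. -/
noncomputable def multiplesSeries (c : ℕ) (T : Set ℕ) : PowerSeries ℚ :=
  PowerSeries.mk fun k => if c ∣ k ∧ k / c ∈ T then 1 else 0

theorem coeff_prod_multiplesSeries (n d : ℕ) (S : ℕ → Set ℕ) :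
    PowerSeries.coeff d (∏ j ∈ range n, multiplesSeries (j + 1) (S j)) =
      (gapPartitions n d S).ncard := by
  classical
  rw [← (bijOn_ofGaps n d S).image_eq, (bijOn_ofGaps n d S).injOn.ncard_image,
    Set.ncard_coe_finset, PowerSeries.coeff_prod, gapFinset, card_filter, Nat.cast_sum]
  refine sum_congr rfl fun f _ => ?_
  simp only [multiplesSeries, PowerSeries.coeff_mk, prod_boole, Nat.cast_ite, Nat.cast_one,
    Nat.cast_zero]

theorem multiplesSeries_Ici_mul {c : ℕ} (hc : 0 < c) (a : ℕ) :
    multiplesSeries c (Set.Ici a) * (1 - PowerSeries.X ^ c) = PowerSeries.X ^ (c * a) := by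
  ext k
  rw [mul_sub, mul_one, map_sub, PowerSeries.coeff_mul_X_pow', PowerSeries.coeff_X_pow]
  simp only [multiplesSeries, PowerSeries.coeff_mk, Set.mem_Ici]
  by_cases hk : c ∣ k
  · obtain ⟨m, rfl⟩ := hk
    rcases m with _ | m
    · rcases a with _ | a
      · simp [hc.ne']
      · simp [hc.ne']
    · have h1 : c * (m + 1) - c = c * m := by rw [mul_add, mul_one, Nat.add_sub_cancel]
      have h2 : c ≤ c * (m + 1) := Nat.le_mul_of_pos_right c m.succ_pos
      rw [h1]
      simp only [dvd_mul_right, true_and, Nat.mul_div_cancel_left _ hc, h2, if_true,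
        Nat.mul_right_inj hc.ne']
      split_ifs <;> first | omega | norm_num
  · have h1 : ¬ (c ≤ k ∧ c ∣ k - c) := fun h =>
      hk ((Nat.dvd_sub_iff_left h.1 dvd_rfl).1 h.2)
    have h2 : k ≠ c * a := fun h => hk (h ▸ dvd_mul_right c a)
    rw [if_neg (fun h => hk h.1), if_neg h2]
    split_ifs with h3 h4
    · exact absurd ⟨h3, h4.1⟩ h1
    · simp
    · simp

theorem multiplesSeries_zero (c : ℕ) : multiplesSeries c {0} = 1 := by
  ext k
  rw [PowerSeries.coeff_one]
  simp only [multiplesSeries, PowerSeries.coeff_mk, Set.mem_singleton_iff]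
  refine if_congr ⟨fun h => ?_, fun h => ?_⟩ rfl rfl
  · rw [← Nat.mul_div_cancel' h.1, h.2, mul_zero]
  · simp [h]

/-- The least difference `l j - l (j + 1)` allowed by `Case3` with distinguished index `i`. -/
def minGap (n i j : ℕ) : ℕ :=
  if j = i then 0 else if j + 1 = i then 1 else if j + 1 < n then 2 else 0

/-- The differences `l j - l (j + 1)` allowed by `Case3` with distinguished index `i`. -/
def gapSet (n i j : ℕ) : Set ℕ :=
  if j = i then {0} else Set.Ici (minGap n i j)

theorem multiplesSeries_gapSet_mul (n i j : ℕ) :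
    multiplesSeries (j + 1) (gapSet n i j) * (1 - PowerSeries.X ^ (j + 1)) =
      PowerSeries.X ^ ((j + 1) * minGap n i j) *
        if j = i then 1 - PowerSeries.X ^ (i + 1) else 1 := by
  by_cases h : j = i
  · subst h
    simp [gapSet, minGap, multiplesSeries_zero]
  · simp only [gapSet, h, if_false, mul_one]
    exact multiplesSeries_Ici_mul j.succ_pos _

theorem sum_minGap {n i : ℕ} (hi : i + 1 < n) :
    ∑ j ∈ range n, (j + 1) * minGap n i j = (n - 2) ^ 2 + 3 * (n - 2 - i) := by
  obtain ⟨m, rfl⟩ := Nat.exists_eq_add_of_le' (show 2 ≤ n by omega)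
  have htotal : ∀ m : ℕ, ∑ j ∈ range m, (j + 1) * 2 = m * (m + 1) := by
    intro m
    induction m with
    | zero => rfl
    | succ m ih => rw [sum_range_succ, ih]; ring
  have key : ∑ j ∈ range (m + 2), ((j + 1) * minGap (m + 2) i j + (if j = i then (j + 1) * 2 else 0)
      + (if j + 1 = i then j + 1 else 0)) =
      ∑ j ∈ range (m + 2), (if j < m + 1 then (j + 1) * 2 else 0) := by
    refine sum_congr rfl fun j hj => ?_
    rw [mem_range] at hj
    simp only [minGap]
    split_ifs <;> omega
  have hlast : ∑ j ∈ range (m + 2), (if j < m + 1 then (j + 1) * 2 else 0) =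
      (m + 1) * (m + 2) := by
    rw [sum_range_succ, if_neg (lt_irrefl _), add_zero, ← htotal (m + 1)]
    exact sum_congr rfl fun j hj => if_pos (mem_range.1 hj)
  have hpred : ∑ j ∈ range (m + 2), (if j + 1 = i then j + 1 else 0) = i := by
    rcases i with _ | i
    · simp
    · simp only [Nat.add_right_cancel_iff]
      rw [sum_ite_eq' (range (m + 2)) i, if_pos (mem_range.2 (by omega))]
  rw [sum_add_distrib, sum_add_distrib, hlast, hpred, sum_ite_eq' (range (m + 2)) i,
    if_pos (mem_range.2 (by omega))] at key
  obtain ⟨t, rfl⟩ := Nat.exists_eq_add_of_le (show i ≤ m by omega)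
  simp only [Nat.add_sub_cancel, Nat.add_sub_cancel_left]
  nlinarith

theorem prod_multiplesSeries_gapSet_mul_qPoch {n i : ℕ} (hi : i + 1 < n) :
    (∏ j ∈ range n, multiplesSeries (j + 1) (gapSet n i j)) * qPoch n =
      PowerSeries.X ^ ((n - 2) ^ 2 + 3 * (n - 2 - i)) * (1 - PowerSeries.X ^ (i + 1)) := by
  rw [qPoch, ← prod_mul_distrib, prod_congr rfl fun j _ => multiplesSeries_gapSet_mul n i j,
    prod_mul_distrib, prod_pow_eq_pow_sum, sum_minGap hi, prod_ite_eq' (range n) i,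
    if_pos (mem_range.2 (by omega))]

theorem case3_iff {n : ℕ} {l : ℕ → ℕ} (hl : Antitone l) :
    Case3 n l ↔ ∃ i ∈ range (n - 1), ∀ j < n, l j - l (j + 1) ∈ gapSet n i j := by
  simp only [Case3, mem_range, gapSet, minGap]
  refine exists_congr fun i => ⟨?_, ?_⟩
  · rintro ⟨hi, h0, h1, h2⟩
    refine ⟨by omega, fun j hj => ?_⟩
    split_ifs with ha hb hc
    · subst ha
      simp [h0]
    · subst hb
      have := h1 (by omega)
      simp only [Nat.add_sub_cancel] at this
      simp only [Set.mem_Ici]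
      omega
    · have := h2 j hc (by omega)
      simp only [Set.mem_Ici]
      omega
    · simp
  · rintro ⟨hi, h⟩
    refine ⟨by omega, ?_, fun hpos => ?_, fun j hj hij => ?_⟩
    · have h0 := h i (by omega)
      have := hl (Nat.le_succ i)
      simp only [if_true, Set.mem_singleton_iff, Nat.succ_eq_add_one] at h0 this
      omega
    · obtain ⟨i, rfl⟩ := Nat.exists_eq_add_of_le' hpos
      have h1 := h i (by omega)
      rw [if_neg (by omega), if_neg (by omega), if_pos rfl, Set.mem_Ici] at h1
      simp only [Nat.add_sub_cancel]
      omega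
    · have h2 := h j (by omega)
      rw [if_neg (by omega), if_neg (by omega), if_neg (by omega), if_pos hj, Set.mem_Ici] at h2
      omega

theorem gapSet_disjoint {n : ℕ} (d : ℕ) :
    (range (n - 1) : Set ℕ).PairwiseDisjoint fun i => gapPartitions n d (gapSet n i) := by
  have hlt : ∀ i k, i < k → k < n - 1 → ∀ l, l ∈ gapPartitions n d (gapSet n i) →
      l ∉ gapPartitions n d (gapSet n k) := by
    rintro i k hik hk l ⟨-, -, hi⟩ ⟨-, -, hk'⟩
    have h1 := hi k (by omega)
    have h2 := hk' k (by omega)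
    simp only [gapSet, minGap, if_true, Set.mem_singleton_iff] at h2
    rw [h2, gapSet, minGap, if_neg (by omega), if_neg (by omega), if_neg (by omega),
      if_pos (by omega), Set.mem_Ici] at h1
    omega
  intro i hi k hk hik
  simp only [coe_range, Set.mem_Iio] at hi hk
  refine Set.disjoint_left.2 fun l h1 h2 => ?_
  rcases lt_or_gt_of_ne hik with h | h
  · exact hlt i k h hk l h1 h2
  · exact hlt k i h hi l h2 h1

theorem ncard_case3 (n d : ℕ) :
    {l : ℕ → ℕ | PartitionN n l ∧ (∑ j ∈ range n, l j) = d ∧ Case3 n l}.ncard =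
      ∑ i ∈ range (n - 1), (gapPartitions n d (gapSet n i)).ncard := by
  have hunion : {l : ℕ → ℕ | PartitionN n l ∧ (∑ j ∈ range n, l j) = d ∧ Case3 n l} =
      ⋃ i ∈ (range (n - 1) : Set ℕ), gapPartitions n d (gapSet n i) := by
    ext l
    simp only [gapPartitions, Set.mem_iUnion, Set.mem_ofPred_eq, mem_coe]
    constructor
    · rintro ⟨hp, hs, hc⟩
      obtain ⟨i, hi, h⟩ := (case3_iff hp.1).1 hc
      exact ⟨i, hi, hp, hs, h⟩
    · rintro ⟨i, hi, hp, hs, h⟩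
      exact ⟨hp, hs, (case3_iff hp.1).2 ⟨i, hi, h⟩⟩
  rw [hunion, (finite_toSet _).ncard_biUnion (fun i _ => finite_gapPartitions n d _)
    (gapSet_disjoint d), finsum_mem_coe_finset]

theorem constantCoeff_qPoch (s : ℕ) : PowerSeries.constantCoeff (qPoch s) = 1 := by
  simp [qPoch]

theorem case3_generating_function (n : ℕ) (hn : 4 ≤ n) :
    PowerSeries.mk (fun d => (Set.ncard {l : ℕ → ℕ | PartitionN n l ∧
        (∑ j ∈ Finset.range n, l j) = d ∧ Case3 n l} : ℚ)) =
      PowerSeries.X ^ ((n - 2) ^ 2) * (qPoch n)⁻¹ *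
        ∑ i ∈ Finset.range (n - 1), PowerSeries.X ^ (3 * i) *
          (1 - PowerSeries.X ^ (n - 1 - i)) := by
  rw [mul_right_comm, PowerSeries.eq_mul_inv_iff_mul_eq (by simp [constantCoeff_qPoch])]
  have hmk : PowerSeries.mk (fun d => (Set.ncard {l : ℕ → ℕ | PartitionN n l ∧
      (∑ j ∈ Finset.range n, l j) = d ∧ Case3 n l} : ℚ)) =
      ∑ i ∈ range (n - 1), ∏ j ∈ range n, multiplesSeries (j + 1) (gapSet n i j) := by
    ext d
    rw [PowerSeries.coeff_mk, ncard_case3, Nat.cast_sum, map_sum]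
    exact sum_congr rfl fun i _ => (coeff_prod_multiplesSeries n d _).symm
  rw [hmk, sum_mul, ← sum_range_reflect, mul_sum]
  refine sum_congr rfl fun i hi => ?_
  rw [mem_range] at hi
  rw [prod_multiplesSeries_gapSet_mul_qPoch (by omega), pow_add, mul_assoc,
    show n - 2 - (n - 1 - 1 - i) = i by omega, show n - 1 - 1 - i + 1 = n - 1 - i by omega]
end

section
/- For every integer n ≥ 4: I_{n,d} = {0} for every d < (n−1)(n−3), and dim_ℂ I_{n,(n−1)(n−3)} = 1. In other words, the minimal degree of a nonzero element of the ideal I_n is (n−1)(n−3), and the component of that degree is one-dimensional. -/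
open MvPolynomial Finset

/-- The ideal `I_n` (degree-`d` component): symmetric polynomials in `n` variables over `ℂ`
vanishing under the substitution `x₂ := x₁`, `x₄ := x₃`, homogeneous of degree `d`. -/
noncomputable def IComponent (n : ℕ) (hn : 4 ≤ n) (d : ℕ) :
    Submodule ℂ (MvPolynomial (Fin n) ℂ) :=
  (Subalgebra.toSubmodule (MvPolynomial.symmetricSubalgebra (Fin n) ℂ) :
      Submodule ℂ (MvPolynomial (Fin n) ℂ)) ⊓
  LinearMap.ker (MvPolynomial.aeval (R := ℂ)
      (fun i : Fin n => if (i : ℕ) = 1 then X (⟨0, by omega⟩ : Fin n)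
        else if (i : ℕ) = 3 then X (⟨2, by omega⟩ : Fin n)
        else (X i : MvPolynomial (Fin n) ℂ))).toLinearMap ⊓
  MvPolynomial.homogeneousSubmodule (Fin n) ℂ d

section Divisibility

theorem rename_eq_zero_of_isSymmetric {σ : Type*} {f : MvPolynomial σ ℂ} (hf : f.IsSymmetric)
    {κ k : σ → σ} (h : rename κ f = 0) (e : Equiv.Perm σ)
    (hk : ∀ a b, κ a = κ b → k (e a) = k (e b)) : rename k f = 0 := by
  obtain ⟨s, hs⟩ : ∃ s : σ → σ, k ∘ e = s ∘ κ :=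
    ⟨Function.extend κ (k ∘ e) id, funext fun a =>
      (Function.FactorsThrough.extend_apply (fun a b hab => hk a b hab) id a).symm⟩
  rw [← hf e, rename_rename, hs, ← rename_rename, h, map_zero]

variable {σ : Type*} [DecidableEq σ]

theorem X_sub_X_dvd_of_rename_update_eq_zero {i j : σ} {p : MvPolynomial σ ℂ}
    (h : rename (Function.update id j i) p = 0) : (X i - X j : MvPolynomial σ ℂ) ∣ p := by
  have key : (Ideal.Quotient.mkₐ ℂ (Ideal.span {(X i - X j : MvPolynomial σ ℂ)})).comp
      (rename (Function.update id j i)) =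
      Ideal.Quotient.mkₐ ℂ (Ideal.span {(X i - X j : MvPolynomial σ ℂ)}) := by
    refine algHom_ext fun k => ?_
    rw [AlgHom.comp_apply, rename_X]
    rcases eq_or_ne k j with rfl | hk
    · simp only [Function.update_self, Ideal.Quotient.mkₐ_eq_mk]
      exact Ideal.Quotient.eq.2 (Ideal.mem_span_singleton_self _)
    · simp [Function.update_of_ne hk]
  have h' := DFunLike.congr_fun key p
  rw [AlgHom.comp_apply, h, map_zero] at h'
  exact Ideal.mem_span_singleton.1 (Ideal.Quotient.eq_zero_iff_mem.1 h'.symm)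

theorem X_sub_X_sq_dvd {i j : σ} (hij : i ≠ j) {p : MvPolynomial σ ℂ}
    (hs : rename (Equiv.swap i j) p = p)
    (h : rename (Function.update id j i) p = 0) : (X i - X j : MvPolynomial σ ℂ) ^ 2 ∣ p := by
  obtain ⟨q, rfl⟩ := X_sub_X_dvd_of_rename_update_eq_zero h
  have hne : (X i - X j : MvPolynomial σ ℂ) ≠ 0 := sub_ne_zero.2 fun e => hij (X_injective e)
  have hq : rename (Equiv.swap i j) q = -q := by
    apply mul_left_cancel₀ hne
    simp only [map_mul, map_sub, rename_X, Equiv.swap_apply_left, Equiv.swap_apply_right] at hs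
    linear_combination -hs
  have hc : Function.update id j i ∘ Equiv.swap i j = Function.update id j i := by
    funext k
    simp only [Function.comp, Function.update_apply, Equiv.swap_apply_def, id]
    grind
  have h0 : rename (Function.update id j i) q = 0 := by
    have := congrArg (rename (Function.update id j i)) hq
    rw [rename_rename, hc, map_neg] at this
    exact self_eq_neg.1 this
  rw [sq]
  exact mul_dvd_mul_left _ (X_sub_X_dvd_of_rename_update_eq_zero h0)

theorem isRelPrime_X_sub_X {i j k l : σ} (hij : i ≠ j) (hkl : k ≠ l)
    (h : ¬ (k = i ∧ l = j)) (h' : ¬ (k = j ∧ l = i)) :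
    IsRelPrime (X i - X j : MvPolynomial σ ℂ) (X k - X l) := by
  have hirr : Irreducible (X i - X j : MvPolynomial σ ℂ) := by
    apply irreducible_of_totalDegree_eq_one
    · exact ((isHomogeneous_X ℂ i).sub (isHomogeneous_X ℂ j)).totalDegree
        (sub_ne_zero.2 fun e => hij (X_injective e))
    · intro x hx
      have := hx (Finsupp.single i 1)
      rw [coeff_sub, coeff_X, coeff_X, if_pos rfl,
        if_neg (fun e => hij (Finsupp.single_left_injective one_ne_zero e).symm), sub_zero] at this
      exact isUnit_of_dvd_one this
  rw [hirr.isRelPrime_iff_not_dvd]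
  rintro ⟨q, hq⟩
  have := congrArg (rename (Function.update id j i)) hq
  simp only [map_sub, map_mul, rename_X, Function.update_self, Function.update_of_ne hij, id,
    sub_self, zero_mul, sub_eq_zero] at this
  have := X_injective (R := ℂ) this
  simp only [Function.update_apply, id] at this
  grind

theorem exists_sq_mul_add_sq_mul {f : MvPolynomial σ ℂ} (hf : f.IsSymmetric) {a b c d : σ}
    (hab : a ≠ b) (hac : a ≠ c) (had : a ≠ d) (hbc : b ≠ c) (hbd : b ≠ d) (hcd : c ≠ d)
    (hv : ∀ k : σ → σ, k a = k b → k c = k d → rename k f = 0) :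
    ∃ A B : MvPolynomial σ ℂ, f = (X a - X b) ^ 2 * A + (X c - X d) ^ 2 * B := by
  obtain ⟨B, hB⟩ : (X c - X d : MvPolynomial σ ℂ) ^ 2 ∣ rename (Function.update id b a) f := by
    apply X_sub_X_sq_dvd hcd
    · rw [rename_rename]
      have : ⇑(Equiv.swap c d) ∘ Function.update id b a =
          Function.update id b a ∘ ⇑(Equiv.swap c d) := by
        funext k
        simp only [Function.comp, Function.update_apply, Equiv.swap_apply_def, id]
        grind
      rw [this, ← rename_rename, hf]
    · rw [rename_rename]
      apply hv <;> grind [Function.update_apply]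
  let M : MvPolynomial σ ℂ := C (1 / 2) * (X a + X b)
  let μ : MvPolynomial σ ℂ →ₐ[ℂ] MvPolynomial σ ℂ :=
    aeval fun i => if i = a ∨ i = b then M else X i
  have hμa : μ (X a) = M := by simp [μ]
  have hμb : μ (X b) = M := by simp [μ]
  have hμ : ∀ i, i ≠ a → i ≠ b → μ (X i) = X i := fun i h1 h2 => by simp [μ, h1, h2]
  have hμk : ∀ p, μ (rename (Function.update id b a) p) = μ p := by
    intro p
    rw [← AlgHom.comp_apply]
    congr 1
    refine algHom_ext fun i => ?_
    rw [AlgHom.comp_apply, rename_X]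
    rcases eq_or_ne i b with rfl | h
    · rw [Function.update_self, hμa, hμb]
    · rw [Function.update_of_ne h, id]
  obtain ⟨A, hA⟩ : (X a - X b : MvPolynomial σ ℂ) ^ 2 ∣ f - μ f := by
    apply X_sub_X_sq_dvd hab
    · rw [map_sub, hf]
      congr 1
      rw [← AlgHom.comp_apply]
      congr 1
      refine algHom_ext fun i => ?_
      rw [AlgHom.comp_apply]
      by_cases h1 : i = a
      · subst h1; rw [hμa]; simp [M, add_comm]
      by_cases h2 : i = b
      · subst h2; rw [hμb]; simp [M, add_comm]
      rw [hμ i h1 h2, rename_X, Equiv.swap_apply_of_ne_of_ne h1 h2]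
    · rw [map_sub, sub_eq_zero, ← AlgHom.comp_apply]
      congr 1
      refine algHom_ext fun i => ?_
      rw [AlgHom.comp_apply, rename_X]
      have hM : rename (Function.update id b a) M = X a := by
        have h2 : (C (1 / 2) * 2 : MvPolynomial σ ℂ) = 1 := by
          rw [← map_ofNat C 2, ← C_mul]; norm_num
        simp only [M, map_mul, rename_C, map_add, rename_X, Function.update_self,
          Function.update_of_ne hab, id]
        linear_combination X a * h2
      by_cases h1 : i = a
      · subst h1; rw [hμa, hM, Function.update_of_ne hab, id]
      by_cases h2 : i = b
      · subst h2; rw [hμb, hM, Function.update_self]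
      rw [hμ i h1 h2, rename_X]
  refine ⟨A, μ B, ?_⟩
  have h1 : μ f = (X c - X d) ^ 2 * μ B := by
    rw [← hμk, hB, map_mul, map_pow, map_sub, hμ c hac.symm hbc.symm, hμ d had.symm hbd.symm]
  rw [← hA, ← h1, sub_add_cancel]

theorem X_sub_X_cube_dvd {f : MvPolynomial σ ℂ} (hf : f.IsSymmetric) {a b c d : σ}
    (hab : a ≠ b) (hac : a ≠ c) (had : a ≠ d) (hbc : b ≠ c) (hbd : b ≠ d) (hcd : c ≠ d)
    (hv : ∀ k : σ → σ, k a = k b → k c = k d → rename k f = 0)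
    {k : σ → σ} (ka : k a = a) (kb : k b = a) (kc : k c = a) (kd : k d = d) :
    (X a - X d : MvPolynomial σ ℂ) ^ 3 ∣ rename k f := by
  obtain ⟨A, B, h⟩ := exists_sq_mul_add_sq_mul hf hab hac had hbc hbd hcd hv
  have hne : (X a - X d : MvPolynomial σ ℂ) ^ 2 ≠ 0 :=
    pow_ne_zero _ (sub_ne_zero.2 fun e => had (X_injective e))
  let k₁ : σ → σ := k ∘ Equiv.swap a d
  let k₂ : σ → σ := Function.update (Function.update k₁ b a) c d
  let T := Function.update id d a
  have h0 : rename k f = (X a - X d) ^ 2 * rename k B := by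
    conv_lhs => rw [h]
    simp only [map_add, map_mul, map_pow, map_sub, rename_X, ka, kb, kc, kd]
    ring
  have h1 : rename k f = (X a - X d) ^ 2 * rename k₁ A := by
    have : rename k f = rename k₁ f := by
      simp only [k₁]
      rw [← rename_rename, hf]
    rw [this]
    conv_lhs => rw [h]
    have e1 : k₁ a = d := by simp [k₁, kd]
    have e2 : k₁ b = a := by simp [k₁, Equiv.swap_apply_of_ne_of_ne hab.symm hbd, kb]
    have e3 : k₁ c = a := by simp [k₁, Equiv.swap_apply_of_ne_of_ne hac.symm hcd, kc]
    have e4 : k₁ d = a := by simp [k₁, ka]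
    simp only [map_add, map_mul, map_pow, map_sub, rename_X, e1, e2, e3, e4]
    ring
  have f1 : k₂ a = d := by simp [k₂, k₁, hab, hac, kd]
  have f2 : k₂ b = a := by simp [k₂, hbc]
  have f3 : k₂ c = d := by simp [k₂]
  have f4 : k₂ d = a := by simp [k₂, k₁, hbd.symm, hcd.symm, ka]
  have h2 : rename k₂ A + rename k₂ B = 0 := by
    have hz : rename k₂ f = 0 := by
      have hsw : rename (k₂ ∘ Equiv.swap b c) f = 0 := by
        apply hv
        · simp [Equiv.swap_apply_of_ne_of_ne hab hac, f1, f3]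
        · simp [Equiv.swap_apply_of_ne_of_ne hbd.symm hcd.symm, f2, f4]
      rwa [← rename_rename, hf] at hsw
    rw [h] at hz
    simp only [map_add, map_mul, map_pow, map_sub, rename_X, f1, f2, f3, f4] at hz
    apply (mul_eq_zero.1 (_ : (X a - X d : MvPolynomial σ ℂ) ^ 2 * _ = 0)).resolve_left hne
    linear_combination hz
  have h3 : rename k B = rename k₁ A := mul_left_cancel₀ hne (h0.symm.trans h1)
  have T1 : T ∘ k₁ = T ∘ k := by
    funext i
    simp only [T, k₁, Function.comp, Function.update_apply, Equiv.swap_apply_def, id]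
    grind
  have T2 : T ∘ k₂ = T ∘ k := by
    funext i
    simp only [T, k₂, k₁, Function.comp, Function.update_apply, Equiv.swap_apply_def, id]
    grind
  have h4 := congrArg (rename T) h3
  have h5 := congrArg (rename T) h2
  rw [rename_rename, rename_rename, T1] at h4
  rw [map_add, rename_rename, rename_rename, T2, map_zero, ← h4] at h5
  have h6 : rename T (rename k B) = 0 := by
    rw [rename_rename]
    exact add_self_eq_zero.1 h5
  rw [h0, pow_succ]
  exact mul_dvd_mul_left _ (X_sub_X_dvd_of_rename_update_eq_zero h6)

end Divisibility

section DegreeBound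

theorem sum_lt_pairs_eq (a c s : ℕ) (ha : 1 ≤ a) :
    (∑ p : Fin (a + s) × Fin (a + s) with p.1 < p.2,
      if a ≤ (p.2 : ℕ) then (if (p.1 : ℕ) = 0 then c else if a ≤ (p.1 : ℕ) then 2 else 0) else 0)
      + s = s * c + s * s := by
  have inner : ∀ t, ∑ i ∈ range (a + t), (if i = 0 then c else if a ≤ i then 2 else 0)
      = c + 2 * t := by
    intro t
    induction t with
    | zero =>
      rw [Finset.sum_eq_single 0]
      · simp
      · intro b hb hb0
        have := mem_range.1 hb
        rw [if_neg hb0, if_neg (by omega)]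
      · intro h
        simp at h
        omega
    | succ t ih =>
      rw [← add_assoc, sum_range_succ, ih, if_neg (by omega), if_pos (by omega)]
      ring
  have outer : ∀ s, (∑ j ∈ range (a + s), (if a ≤ j then c + 2 * (j - a) else 0)) + s
      = s * c + s * s := by
    intro s
    induction s with
    | zero =>
      simp only [add_zero, zero_mul]
      exact sum_eq_zero fun j hj => if_neg (by have := mem_range.1 hj; omega)
    | succ s ih =>
      rw [← add_assoc a s 1, sum_range_succ, if_pos (by omega), Nat.add_sub_cancel_left]
      linear_combination ih
  rw [← outer s, sum_filter, Fintype.sum_prod_type_right,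
    ← Fin.sum_univ_eq_sum_range (fun j => if a ≤ j then c + 2 * (j - a) else 0)]
  congr 1
  refine sum_congr rfl fun j _ => ?_
  by_cases hj : a ≤ (j : ℕ)
  · simp only [if_pos hj, Fin.lt_def]
    rw [← inner, Nat.add_sub_cancel' hj, Fin.sum_univ_eq_sum_range
      (fun i => if i < (j : ℕ) then (if i = 0 then c else if a ≤ i then 2 else 0) else 0),
      ← sum_filter]
    congr 1
    ext i
    simp only [mem_filter, mem_range]
    omega
  · simp [hj]

theorem eq_zero_of_forall_pow_dvd {n d : ℕ} {p : MvPolynomial (Fin n) ℂ} (hp : p.IsHomogeneous d)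
    (m : Fin n × Fin n → ℕ)
    (hdvd : ∀ q : Fin n × Fin n, q.1 < q.2 → (X q.1 - X q.2 : MvPolynomial (Fin n) ℂ) ^ m q ∣ p)
    (hd : d ≤ ∑ q : Fin n × Fin n with q.1 < q.2, m q)
    (h : d = ∑ q : Fin n × Fin n with q.1 < q.2, m q → ∃ w : Fin n → ℂ,
      (∀ q : Fin n × Fin n, q.1 < q.2 → m q ≠ 0 → w q.1 ≠ w q.2) ∧ eval w p = 0) :
    p = 0 := by
  obtain ⟨r, hr⟩ : ∏ q : Fin n × Fin n with q.1 < q.2,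
      (X q.1 - X q.2 : MvPolynomial (Fin n) ℂ) ^ m q ∣ p := by
    apply Finset.prod_dvd_of_isRelPrime
    · rintro ⟨i, j⟩ hij ⟨k, l⟩ hkl hne
      simp only [coe_filter, mem_univ, true_and, Set.mem_ofPred_eq] at hij hkl
      apply IsRelPrime.pow
      apply isRelPrime_X_sub_X hij.ne hkl.ne
      · rintro ⟨rfl, rfl⟩
        exact hne rfl
      · rintro ⟨rfl, rfl⟩
        exact absurd hij hkl.asymm
    · intro q hq
      exact hdvd q (mem_filter.1 hq).2
  set D : MvPolynomial (Fin n) ℂ := ∏ q : Fin n × Fin n with q.1 < q.2, (X q.1 - X q.2) ^ m q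
    with hD
  have hDh : D.IsHomogeneous (∑ q : Fin n × Fin n with q.1 < q.2, m q) := by
    apply IsHomogeneous.prod
    intro q _
    simpa using ((isHomogeneous_X ℂ q.1).sub (isHomogeneous_X ℂ q.2)).pow (m q)
  by_contra hp0
  have hD0 : D ≠ 0 := by
    rintro h0
    rw [h0, zero_mul] at hr
    exact hp0 hr
  have hr0 : r ≠ 0 := by
    rintro rfl
    rw [mul_zero] at hr
    exact hp0 hr
  have hdeg := congrArg totalDegree hr
  rw [hp.totalDegree hp0, totalDegree_mul_of_isDomain hD0 hr0, hDh.totalDegree hD0] at hdeg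
  obtain ⟨w, hw, hpw⟩ := h (by omega)
  rw [totalDegree_eq_zero_iff_eq_C.1 (by omega : r.totalDegree = 0)] at hr hr0
  rw [hr, map_mul, eval_C, hD, map_prod] at hpw
  rcases mul_eq_zero.1 hpw with h0 | h0
  · obtain ⟨q, hq, hq0⟩ := prod_eq_zero_iff.1 h0
    rw [map_pow, map_sub, eval_X, eval_X] at hq0
    obtain ⟨h1, h2⟩ := (pow_eq_zero_iff').1 hq0
    exact hw q (mem_filter.1 hq).2 h2 (sub_eq_zero.1 h1)
  · rw [h0, map_zero] at hr0
    exact hr0 rfl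

/-- The map sending the first `a` indices to `0` and fixing the other ones. -/
def collapse (m a : ℕ) (i : Fin (m + 4)) : Fin (m + 4) := if (i : ℕ) < a then 0 else i

theorem collapse_of_lt {m a : ℕ} {i : Fin (m + 4)} (h : (i : ℕ) < a) : collapse m a i = 0 :=
  if_pos h

theorem collapse_of_le {m a : ℕ} {i : Fin (m + 4)} (h : a ≤ (i : ℕ)) : collapse m a i = i :=
  if_neg (by omega)

theorem exists_perm_apply_eq {m r : ℕ} (hr : r ≤ m + 4) (y : Fin r → Fin (m + 4))
    (hy : Function.Injective y) :
    ∃ e : Equiv.Perm (Fin (m + 4)), ∀ i, e (Fin.castLE hr i) = y i := by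
  obtain ⟨e, he⟩ := (Equiv.Perm.isMultiplyPretransitive (Fin (m + 4)) r).exists_smul_eq
    (Fin.castLEEmb hr) ⟨y, hy⟩
  exact ⟨e, fun i => DFunLike.congr_fun he i⟩

theorem rename_eq_zero_of_rename_collapse {m r : ℕ} (hr : r ≤ m + 4)
    {f : MvPolynomial (Fin (m + 4)) ℂ} (hf : f.IsSymmetric)
    (h : rename (collapse m r) f = 0) (y : Fin r → Fin (m + 4)) (hy : Function.Injective y)
    (k : Fin (m + 4) → Fin (m + 4)) (hk : ∀ i j, k (y i) = k (y j)) : rename k f = 0 := by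
  obtain ⟨e, he⟩ := exists_perm_apply_eq hr y hy
  refine rename_eq_zero_of_isSymmetric hf h e fun a b hab => ?_
  have key : ∀ a : Fin (m + 4), (ha : (a : ℕ) < r) → e a = y ⟨a, ha⟩ := fun a ha => he ⟨a, ha⟩
  simp only [collapse] at hab
  split_ifs at hab with h1 h2 h2
  · rw [key a h1, key b h2]; exact hk _ _
  · subst hab; exact absurd (by simp; omega) h2
  · subst hab; exact absurd (by simp; omega) h1
  · rw [hab]

theorem rename_swap_rename_collapse {m a : ℕ} {f : MvPolynomial (Fin (m + 4)) ℂ}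
    (hf : f.IsSymmetric) {i j : Fin (m + 4)} (hi : a ≤ (i : ℕ)) (hj : a ≤ (j : ℕ)) :
    rename (Equiv.swap i j) (rename (collapse m a) f) = rename (collapse m a) f := by
  rcases Nat.eq_zero_or_pos a with rfl | ha
  · rw [(funext fun i => collapse_of_le (Nat.zero_le _) : collapse m 0 = id), rename_id_apply, hf]
  have : ⇑(Equiv.swap i j) ∘ collapse m a = collapse m a ∘ ⇑(Equiv.swap i j) := by
    funext k
    simp only [Function.comp, collapse, Equiv.swap_apply_def]
    have : ((0 : Fin (m + 4)) : ℕ) = 0 := rfl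
    grind
  rw [rename_rename, this, ← rename_rename, hf]

theorem rename_collapse_eq_zero {m a c d : ℕ} (ha : 1 ≤ a) (ham : a ≤ m + 4)
    {f : MvPolynomial (Fin (m + 4)) ℂ} (hf : f.IsSymmetric) (hh : f.IsHomogeneous d)
    (hpair : ∀ i j : Fin (m + 4), a ≤ (i : ℕ) → i < j →
      rename (Function.update id j i) (rename (collapse m a) f) = 0)
    (hzero : ∀ j : Fin (m + 4), a ≤ (j : ℕ) →
      (X 0 - X j : MvPolynomial (Fin (m + 4)) ℂ) ^ c ∣ rename (collapse m a) f)
    (hd : d + (m + 4 - a) ≤ (m + 4 - a) * c + (m + 4 - a) * (m + 4 - a))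
    (hw : d + (m + 4 - a) = (m + 4 - a) * c + (m + 4 - a) * (m + 4 - a) →
      ∃ w : Fin (m + 4) → ℂ, (∀ i j : Fin (m + 4), i < j → a ≤ (j : ℕ) → w i ≠ w j) ∧
        eval w (rename (collapse m a) f) = 0) :
    rename (collapse m a) f = 0 := by
  obtain ⟨s, hs⟩ := Nat.exists_eq_add_of_le ham
  have hsum := sum_lt_pairs_eq a c s ha
  rw [← hs] at hsum
  rw [show m + 4 - a = s by omega] at hd hw
  refine eq_zero_of_forall_pow_dvd hh.rename_isHomogeneous (fun p =>
    if a ≤ (p.2 : ℕ) then (if (p.1 : ℕ) = 0 then c else if a ≤ (p.1 : ℕ) then 2 else 0) else 0)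
    ?_ (by omega) ?_
  · rintro ⟨i, j⟩ hij
    dsimp only at hij ⊢
    split_ifs with h1 h2 h3
    · obtain rfl : i = 0 := Fin.ext h2
      exact hzero j h1
    · exact X_sub_X_sq_dvd hij.ne (rename_swap_rename_collapse hf h3 h1) (hpair i j h3 hij)
    · simp
    · simp
  · intro he
    obtain ⟨w, h1, h2⟩ := hw (by omega)
    refine ⟨w, fun q hq hq0 => h1 _ _ hq ?_, h2⟩
    by_contra h
    simp [h] at hq0

/-- The point `(0, 0, 0, 1, 2, …)`, which lies on no hyperplane `xᵢ = xⱼ` with `j` past the third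
coordinate. -/
def triplePoint (m : ℕ) (i : Fin (m + 4)) : ℂ := (((i : ℕ) - 2 : ℕ) : ℂ)

theorem eq_zero_of_vanishing {m d : ℕ} {f : MvPolynomial (Fin (m + 4)) ℂ}
    (hf : f.IsSymmetric) (hh : f.IsHomogeneous d)
    (hv : ∀ k : Fin (m + 4) → Fin (m + 4), ∀ a b c d : Fin (m + 4),
      a ≠ b → a ≠ c → a ≠ d → b ≠ c → b ≠ d → c ≠ d → k a = k b → k c = k d → rename k f = 0)
    (hd : d ≤ (m + 3) * (m + 1))
    (hw : d = (m + 3) * (m + 1) → eval (triplePoint m) f = 0) : f = 0 := by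
  have v0 : ((0 : Fin (m + 4)) : ℕ) = 0 := rfl
  have v1 : ((1 : Fin (m + 4)) : ℕ) = 1 := by simp
  have v2 : ((2 : Fin (m + 4)) : ℕ) = 2 := by simp
  have hne : ∀ {i j : Fin (m + 4)}, (i : ℕ) < j → i ≠ j := fun h e => by simp [e] at h
  have h01 : (0 : Fin (m + 4)) ≠ 1 := hne (by omega)
  have h02 : (0 : Fin (m + 4)) ≠ 2 := hne (by omega)
  have h12 : (1 : Fin (m + 4)) ≠ 2 := hne (by omega)
  have hpair : ∀ a, 2 ≤ a → ∀ i j : Fin (m + 4), a ≤ (i : ℕ) → i < j →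
      rename (Function.update id j i) (rename (collapse m a) f) = 0 := by
    intro a ha i j hi hij
    have hij' : (i : ℕ) < j := hij
    rw [rename_rename]
    refine hv _ 0 1 i j h01 (hne (by omega)) (hne (by omega)) (hne (by omega)) (hne (by omega))
      hij.ne ?_ ?_
    · rw [Function.comp, Function.comp, collapse_of_lt (by omega), collapse_of_lt (by omega)]
    · rw [Function.comp, Function.comp, collapse_of_le hi, collapse_of_le (by omega),
        Function.update_self, Function.update_of_ne hij.ne, id]
  have triple : rename (collapse m 3) f = 0 := by
    refine rename_collapse_eq_zero (c := 3) (by omega) (by omega) hf hh (hpair 3 (by omega)) ?_ ?_ ?_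
    · intro j hj
      exact X_sub_X_cube_dvd hf h01 h02 (hne (by omega)) h12 (hne (by omega)) (hne (by omega))
        (fun k h1 h2 => hv k 0 1 2 j h01 h02 (hne (by omega)) h12 (hne (by omega)) (hne (by omega))
          h1 h2) (collapse_of_lt (by omega)) (collapse_of_lt (by omega)) (collapse_of_lt (by omega))
        (collapse_of_le hj)
    · rw [show m + 4 - 3 = m + 1 by omega]
      nlinarith
    · rw [show m + 4 - 3 = m + 1 by omega]
      intro h
      refine ⟨triplePoint m, fun i j hij hj => ?_, ?_⟩
      · have hij' : (i : ℕ) < j := hij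
        simp only [triplePoint, ne_eq, Nat.cast_inj]
        omega
      · rw [eval_rename, ← hw (by nlinarith)]
        congr 2
        funext i
        simp only [Function.comp, collapse]
        split_ifs with hi
        · simp only [triplePoint, v0, Nat.cast_inj]
          omega
        · rfl
  have double : rename (collapse m 2) f = 0 := by
    refine rename_collapse_eq_zero (c := 1) (by omega) (by omega) hf hh (hpair 2 le_rfl) ?_ ?_ ?_
    · intro j hj
      rw [pow_one]
      apply X_sub_X_dvd_of_rename_update_eq_zero
      rw [rename_rename]
      have h0j : (0 : Fin (m + 4)) ≠ j := hne (by omega)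
      have h1j : (1 : Fin (m + 4)) ≠ j := hne (by omega)
      refine rename_eq_zero_of_rename_collapse (by omega) hf triple ![0, 1, j] ?_ _ ?_
      · intro a b
        fin_cases a <;> fin_cases b <;> simp [h01, h0j, h1j, h01.symm, h0j.symm, h1j.symm]
      · have e : ∀ a, (Function.update id j 0 ∘ collapse m 2) (![0, 1, j] a) = 0 := by
          intro a
          fin_cases a
          · simp [collapse, h0j]
          · simp [collapse, h0j]
          · simp [collapse_of_le hj]
        intro a b
        rw [e, e]
    · rw [show m + 4 - 2 = m + 2 by omega]
      nlinarith
    · rw [show m + 4 - 2 = m + 2 by omega]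
      intro h
      nlinarith
  have hid : collapse m 1 = id := funext fun i => by
    simp only [collapse, id]
    split_ifs with h
    · exact Fin.ext (by omega)
    · rfl
  have pair : ∀ i j : Fin (m + 4), i < j → rename (Function.update id j i) f = 0 := by
    intro i j hij
    refine rename_eq_zero_of_rename_collapse (by omega) hf double ![i, j] ?_ _ ?_
    · intro a b
      fin_cases a <;> fin_cases b <;> simp [hij.ne, hij.ne']
    · intro a b
      fin_cases a <;> fin_cases b <;> simp [hij.ne]
  have single : rename (collapse m 1) f = 0 := by
    refine rename_collapse_eq_zero (c := 2) le_rfl (by omega) hf hh ?_ ?_ ?_ ?_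
    · intro i j _ hij
      rw [hid, rename_id_apply]
      exact pair i j hij
    · intro j hj
      have h0j : (0 : Fin (m + 4)) < j := Fin.lt_def.2 (by omega)
      rw [hid, rename_id_apply]
      exact X_sub_X_sq_dvd h0j.ne (hf _) (pair 0 j h0j)
    · rw [show m + 4 - 1 = m + 3 by omega]
      nlinarith
    · rw [show m + 4 - 1 = m + 3 by omega]
      intro h
      nlinarith
  rwa [hid, rename_id_apply] at single

end DegreeBound

section Generator

/-- The sum over all three-element sets `S` of indices of the product of the discriminant of the
variables outside `S` and of all the differences of a variable in `S` and one outside `S`. -/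
noncomputable def tripleSum (n : ℕ) : MvPolynomial (Fin n) ℂ :=
  ∑ S ∈ powersetCard 3 (univ : Finset (Fin n)),
    (∏ q ∈ Sᶜ.offDiag, (X q.1 - X q.2)) * ∏ q ∈ S ×ˢ Sᶜ, (X q.1 - X q.2)

theorem aeval_tripleSum_term_eq_zero {n : ℕ} {R : Type*} [CommRing R] [Algebra ℂ R]
    (v : Fin n → R) {S : Finset (Fin n)} {i j : Fin n} (hij : i ≠ j) (hv : v i = v j)
    (h : ¬ (i ∈ S ∧ j ∈ S)) :
    aeval v ((∏ q ∈ Sᶜ.offDiag, (X q.1 - X q.2)) * ∏ q ∈ S ×ˢ Sᶜ, (X q.1 - X q.2) :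
      MvPolynomial (Fin n) ℂ) = 0 := by
  rw [map_mul, map_prod, map_prod]
  by_cases hi : i ∈ S
  · have hj : j ∉ S := fun hj => h ⟨hi, hj⟩
    rw [prod_eq_zero (i := (i, j)) (s := S ×ˢ Sᶜ) (by simp [hi, hj]) (by simp [hv]), mul_zero]
  by_cases hj : j ∈ S
  · rw [prod_eq_zero (i := (j, i)) (s := S ×ˢ Sᶜ) (by simp [hi, hj]) (by simp [hv]), mul_zero]
  · rw [prod_eq_zero (i := (i, j)) (s := Sᶜ.offDiag) (by simp [hi, hj, hij]) (by simp [hv]),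
      zero_mul]

theorem isSymmetric_tripleSum (n : ℕ) : (tripleSum n).IsSymmetric := by
  intro e
  rw [tripleSum, map_sum]
  refine sum_bij' (fun S _ => S.map e.toEmbedding) (fun S _ => S.map e.symm.toEmbedding)
    ?_ ?_ ?_ ?_ ?_
  · intro S hS
    simpa using hS
  · intro S hS
    simpa using hS
  · intro S _
    simp [map_map]
  · intro S _
    simp [map_map]
  · intro S _
    rw [map_mul, map_prod, map_prod]
    congr 1
    · refine prod_bij' (fun q _ => (e q.1, e q.2)) (fun q _ => (e.symm q.1, e.symm q.2))
        ?_ ?_ ?_ ?_ ?_ <;> simp [mem_map_equiv]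
    · refine prod_bij' (fun q _ => (e q.1, e q.2)) (fun q _ => (e.symm q.1, e.symm q.2))
        ?_ ?_ ?_ ?_ ?_ <;> simp [mem_map_equiv]

theorem isHomogeneous_tripleSum (m : ℕ) :
    (tripleSum (m + 4)).IsHomogeneous ((m + 3) * (m + 1)) := by
  apply IsHomogeneous.sum
  intro S hS
  have hc : S.card = 3 := (mem_powersetCard.1 hS).2
  have hc' : Sᶜ.card = m + 1 := by rw [card_compl, hc, Fintype.card_fin]; omega
  have key : ∀ E : Finset (Fin (m + 4) × Fin (m + 4)),
      (∏ q ∈ E, (X q.1 - X q.2 : MvPolynomial (Fin (m + 4)) ℂ)).IsHomogeneous E.card := by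
    intro E
    rw [card_eq_sum_ones]
    exact IsHomogeneous.prod _ _ _ fun q _ => (isHomogeneous_X ℂ q.1).sub (isHomogeneous_X ℂ q.2)
  convert (key Sᶜ.offDiag).mul (key (S ×ˢ Sᶜ)) using 1
  rw [offDiag_card, card_product, hc, hc', show (m + 1) * (m + 1) = (m + 1) * m + (m + 1) by ring,
    Nat.add_sub_cancel]
  ring

theorem eval_tripleSum_ne_zero (m : ℕ) : eval (triplePoint m) (tripleSum (m + 4)) ≠ 0 := by
  rw [← coe_aeval_eq_eval, RingHom.coe_coe, tripleSum, map_sum]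
  let T : Finset (Fin (m + 4)) := univ.filter fun i => (i : ℕ) < 3
  have hT : T.card = 3 := by
    have : T = univ.map (Fin.castLEEmb (by omega : 3 ≤ m + 4)) := by
      ext i
      simp only [T, mem_filter, mem_univ, true_and, mem_map, Fin.castLEEmb_apply]
      exact ⟨fun h => ⟨⟨i, h⟩, rfl⟩, by rintro ⟨a, rfl⟩; exact a.2⟩
    rw [this, card_map, card_univ, Fintype.card_fin]
  rw [sum_eq_single T]
  · rw [map_mul, map_prod, map_prod]
    refine mul_ne_zero (prod_ne_zero_iff.2 ?_) (prod_ne_zero_iff.2 ?_)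
    · rintro ⟨i, j⟩ hq
      simp only [T, mem_offDiag, mem_compl, mem_filter, mem_univ, true_and, ne_eq,
        Fin.ext_iff] at hq
      rw [map_sub, aeval_X, aeval_X, sub_ne_zero, triplePoint, triplePoint, ne_eq, Nat.cast_inj]
      dsimp only
      omega
    · rintro ⟨i, j⟩ hq
      simp only [T, mem_product, mem_compl, mem_filter, mem_univ, true_and] at hq
      rw [map_sub, aeval_X, aeval_X, sub_ne_zero, triplePoint, triplePoint, ne_eq, Nat.cast_inj]
      dsimp only
      omega
  · intro S hS hST
    obtain ⟨i, hiT, hiS⟩ : ∃ i ∈ T, i ∉ S := by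
      by_contra! h
      exact hST (eq_of_subset_of_card_le h (by rw [hT, (mem_powersetCard.1 hS).2])).symm
    obtain ⟨j, hjT, hij⟩ := exists_mem_ne (by omega : 1 < T.card) i
    simp only [T, mem_filter, mem_univ, true_and] at hiT hjT
    refine aeval_tripleSum_term_eq_zero _ hij.symm ?_ fun h => hiS h.1
    rw [triplePoint, triplePoint, Nat.cast_inj]
    omega
  · intro h
    exact absurd (mem_powersetCard.2 ⟨subset_univ _, hT⟩) h

theorem aeval_tripleSum_eq_zero {n : ℕ} {R : Type*} [CommRing R] [Algebra ℂ R] (v : Fin n → R)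
    {a b c d : Fin n} (hab : a ≠ b) (hac : a ≠ c) (had : a ≠ d) (hbc : b ≠ c) (hbd : b ≠ d)
    (hcd : c ≠ d) (h1 : v a = v b) (h2 : v c = v d) : aeval v (tripleSum n) = 0 := by
  rw [tripleSum, map_sum]
  refine sum_eq_zero fun S hS => ?_
  by_cases h : a ∈ S ∧ b ∈ S
  · refine aeval_tripleSum_term_eq_zero v hcd h2 fun h' => ?_
    have hsub : ({a, b, c, d} : Finset (Fin n)) ⊆ S := by
      simp [insert_subset_iff, h, h']
    have := card_le_card hsub
    rw [(mem_powersetCard.1 hS).2] at this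
    simp [hab, hac, had, hbc, hbd, hcd] at this
  · exact aeval_tripleSum_term_eq_zero v hab h1 h

end Generator

theorem rename_eq_zero_of_mem_IComponent {m d : ℕ} {hn : 4 ≤ m + 4}
    {f : MvPolynomial (Fin (m + 4)) ℂ} (hf : f ∈ IComponent (m + 4) hn d)
    (k : Fin (m + 4) → Fin (m + 4)) (a b c e : Fin (m + 4))
    (hab : a ≠ b) (hac : a ≠ c) (hae : a ≠ e) (hbc : b ≠ c) (hbe : b ≠ e) (hce : c ≠ e)
    (h1 : k a = k b) (h2 : k c = k e) : rename k f = 0 := by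
  obtain ⟨⟨hs, hk⟩, -⟩ := hf
  let κ : Fin (m + 4) → Fin (m + 4) := fun i =>
    if (i : ℕ) = 1 then ⟨0, by omega⟩ else if (i : ℕ) = 3 then ⟨2, by omega⟩ else i
  have hκ : rename κ f = 0 := by
    rw [← LinearMap.mem_ker.1 hk, AlgHom.toLinearMap_apply]
    congr 1
    refine algHom_ext fun i => ?_
    rw [rename_X, aeval_X]
    simp only [κ]
    split_ifs <;> rfl
  obtain ⟨g, hg⟩ := exists_perm_apply_eq (by omega) ![a, b, c, e] (by
    intro i j
    fin_cases i <;> fin_cases j <;>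
      simp [hab, hac, hae, hbc, hbe, hce, hab.symm, hac.symm, hae.symm, hbc.symm, hbe.symm,
        hce.symm])
  refine rename_eq_zero_of_isSymmetric hs hκ g fun i j hij => ?_
  have g0 : ∀ i : Fin (m + 4), (i : ℕ) = 0 → g i = a := fun i hi => by
    rw [← show g _ = a from hg 0]; congr 1; exact Fin.ext hi
  have g1 : ∀ i : Fin (m + 4), (i : ℕ) = 1 → g i = b := fun i hi => by
    rw [← show g _ = b from hg 1]; congr 1; exact Fin.ext hi
  have g2 : ∀ i : Fin (m + 4), (i : ℕ) = 2 → g i = c := fun i hi => by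
    rw [← show g _ = c from hg 2]; congr 1; exact Fin.ext hi
  have g3 : ∀ i : Fin (m + 4), (i : ℕ) = 3 → g i = e := fun i hi => by
    rw [← show g _ = e from hg 3]; congr 1; exact Fin.ext hi
  have hκv : ∀ i, (κ i : ℕ) = if (i : ℕ) = 1 then 0 else if (i : ℕ) = 3 then 2 else (i : ℕ) := by
    intro i
    simp only [κ]
    split_ifs <;> rfl
  have hij := congrArg Fin.val hij
  rw [hκv, hκv] at hij
  by_cases hieq : i = j
  · rw [hieq]
  have hne : (i : ℕ) ≠ j := fun h => hieq (Fin.ext h)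
  have hpairs : ((i : ℕ) = 0 ∧ (j : ℕ) = 1) ∨ ((i : ℕ) = 1 ∧ (j : ℕ) = 0) ∨
      ((i : ℕ) = 2 ∧ (j : ℕ) = 3) ∨ ((i : ℕ) = 3 ∧ (j : ℕ) = 2) := by
    split_ifs at hij <;> omega
  rcases hpairs with ⟨hi, hj⟩ | ⟨hi, hj⟩ | ⟨hi, hj⟩ | ⟨hi, hj⟩
  · rw [g0 i hi, g1 j hj, h1]
  · rw [g1 i hi, g0 j hj, h1]
  · rw [g2 i hi, g3 j hj, h2]
  · rw [g3 i hi, g2 j hj, h2]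

theorem eq_zero_of_mem_IComponent {m d : ℕ} {hn : 4 ≤ m + 4} {f : MvPolynomial (Fin (m + 4)) ℂ}
    (hf : f ∈ IComponent (m + 4) hn d) (hd : d ≤ (m + 3) * (m + 1))
    (hw : d = (m + 3) * (m + 1) → eval (triplePoint m) f = 0) : f = 0 :=
  eq_zero_of_vanishing hf.1.1 hf.2 (rename_eq_zero_of_mem_IComponent hf) hd hw

theorem tripleSum_mem_IComponent {m : ℕ} (hn : 4 ≤ m + 4) :
    tripleSum (m + 4) ∈ IComponent (m + 4) hn ((m + 3) * (m + 1)) := by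
  refine ⟨⟨isSymmetric_tripleSum _, ?_⟩, isHomogeneous_tripleSum m⟩
  exact aeval_tripleSum_eq_zero _ (a := ⟨0, by omega⟩) (b := ⟨1, by omega⟩) (c := ⟨2, by omega⟩)
    (d := ⟨3, by omega⟩) (by simp) (by simp) (by simp) (by simp) (by simp) (by simp) (by simp)
    (by simp)

/-- The minimal degree of a nonzero element of `I_n` is `(n-1)(n-3)`, and the component of
that degree is one-dimensional. -/
theorem In_minimal_degree (n : ℕ) (hn : 4 ≤ n) :
    (∀ d, d < (n - 1) * (n - 3) → IComponent n hn d = ⊥) ∧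
    Module.finrank ℂ (IComponent n hn ((n - 1) * (n - 3))) = 1 := by
  obtain ⟨m, rfl⟩ : ∃ m, n = m + 4 := ⟨n - 4, by omega⟩
  rw [show m + 4 - 1 = m + 3 by omega, show m + 4 - 3 = m + 1 by omega]
  refine ⟨fun d hd => (Submodule.eq_bot_iff _).2 fun f hf =>
    eq_zero_of_mem_IComponent hf hd.le fun h => absurd h hd.ne, ?_⟩
  have hne := eval_tripleSum_ne_zero m
  have hmem := tripleSum_mem_IComponent hn
  refine (finrank_eq_one_iff_of_nonzero' ⟨tripleSum (m + 4), hmem⟩ ?_).2 ?_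
  · intro h
    have h0 : tripleSum (m + 4) = 0 := congrArg Subtype.val h
    exact hne (by rw [h0, map_zero])
  · rintro ⟨f, hf⟩
    refine ⟨eval (triplePoint m) f / eval (triplePoint m) (tripleSum (m + 4)), Subtype.ext ?_⟩
    refine (sub_eq_zero.1 (eq_zero_of_mem_IComponent
      (Submodule.sub_mem _ hf (Submodule.smul_mem _ _ hmem)) le_rfl fun _ => ?_)).symm
    rw [map_sub, smul_eval, div_mul_cancel₀ _ hne, sub_self]
end

section
/- For every integer n ≥ 4, the polynomial Q(x_1,...,x_n) = Σ_{σ ∈ S_n} σ·( ∏_{j=4}^{n} (x_1−x_j)(x_2−x_j)(x_3−x_j) · ∏_{4≤k<l≤n} (x_k−x_l)² ), obtained by symmetrizing over all permutations of the variables, is a nonzero symmetric polynomial, homogeneous of degree (n−1)(n−3), and belongs to the ideal I_n, i.e. it vanishes identically upon substituting x_2 := x_1 and x_4 := x_3. -/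
open MvPolynomial Finset

/-- The polynomial `∏_{j=4}^{n} (x₁-x_j)(x₂-x_j)(x₃-x_j) · ∏_{4≤k<l≤n} (x_k-x_l)²`
(variables 0-indexed: `X 0, …, X (n-1)` are `x₁, …, x_n`). -/
noncomputable def baseQ (n : ℕ) (hn : 4 ≤ n) : MvPolynomial (Fin n) ℂ :=
  (∏ j ∈ Finset.univ.filter (fun j : Fin n => 3 ≤ (j : ℕ)),
      ((X (⟨0, by omega⟩ : Fin n) - X j) * (X (⟨1, by omega⟩ : Fin n) - X j) *
        (X (⟨2, by omega⟩ : Fin n) - X j))) *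
  ∏ p ∈ Finset.univ.filter (fun p : Fin n × Fin n => 3 ≤ (p.1 : ℕ) ∧ p.1 < p.2),
      (X p.1 - X p.2) ^ 2

/-- `Q = ∑_{σ ∈ S_n} σ · baseQ`, the symmetrization over all permutations of the variables. -/
noncomputable def Qpoly (n : ℕ) (hn : 4 ≤ n) : MvPolynomial (Fin n) ℂ :=
  ∑ σ : Equiv.Perm (Fin n), rename (⇑σ) (baseQ n hn)

theorem aeval_baseQ {A : Type*} [CommRing A] [Algebra ℂ A] (n : ℕ) (hn : 4 ≤ n) (a : Fin n → A) :
    aeval a (baseQ n hn) =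
      (∏ j ∈ Finset.univ.filter (fun j : Fin n => 3 ≤ (j : ℕ)),
        ((a ⟨0, by omega⟩ - a j) * (a ⟨1, by omega⟩ - a j) * (a ⟨2, by omega⟩ - a j))) *
      ∏ p ∈ Finset.univ.filter (fun p : Fin n × Fin n => 3 ≤ (p.1 : ℕ) ∧ p.1 < p.2),
        (a p.1 - a p.2) ^ 2 := by
  simp only [baseQ, map_mul, map_prod, map_sub, map_pow, aeval_X]

theorem aeval_baseQ_eq_zero {A : Type*} [CommRing A] [Algebra ℂ A] (n : ℕ) (hn : 4 ≤ n)
    (a : Fin n → A) {u v : Fin n} (huv : u ≠ v) (ha : a u = a v) (hv : 3 ≤ (v : ℕ)) :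
    aeval a (baseQ n hn) = 0 := by
  rw [aeval_baseQ]
  by_cases hu : 3 ≤ (u : ℕ)
  · apply mul_eq_zero_of_right
    rcases lt_or_gt_of_ne huv with h | h
    · exact Finset.prod_eq_zero (i := (u, v)) (by simp [hu, h]) (by simp [ha])
    · exact Finset.prod_eq_zero (i := (v, u)) (by simp [hv, h]) (by simp [ha])
  · apply mul_eq_zero_of_left
    refine Finset.prod_eq_zero (i := v) (by simp [hv]) ?_
    obtain ⟨u, hun⟩ := u
    obtain rfl | rfl | rfl : u = 0 ∨ u = 1 ∨ u = 2 := by simp only at hu; omega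
    all_goals simp [ha]

theorem symm_apply_lt_three_of_aeval_ne_zero {A : Type*} [CommRing A] [Algebra ℂ A] {n : ℕ}
    {hn : 4 ≤ n} {a : Fin n → A} {σ : Equiv.Perm (Fin n)}
    (h : aeval a (rename σ (baseQ n hn)) ≠ 0) {u v : Fin n} (huv : u ≠ v) (ha : a u = a v) :
    (σ.symm v : ℕ) < 3 := by
  by_contra! hv
  rw [aeval_rename] at h
  exact h (aeval_baseQ_eq_zero n hn _ (u := σ.symm u) (v := σ.symm v) (by simpa using huv)
    (by simpa using ha) hv)

theorem Qpoly_isSymmetric (n : ℕ) (hn : 4 ≤ n) : (Qpoly n hn).IsSymmetric := by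
  intro τ
  simp only [Qpoly, map_sum, rename_rename, ← Equiv.Perm.coe_mul]
  exact Fintype.sum_equiv (Equiv.mulLeft τ) _ _ fun σ => rfl

theorem two_mul_sum_range_sub_three (m : ℕ) :
    2 * ∑ j ∈ range (m + 4), (j - 3) = (m + 1) * m := by
  induction m with
  | zero => decide
  | succ m ih =>
    rw [show m + 1 + 4 = (m + 4) + 1 by ring, Finset.sum_range_succ, mul_add, ih,
      show m + 4 - 3 = m + 1 by omega]
    ring

theorem card_filter_three_le (n : ℕ) (hn : 4 ≤ n) :
    #(univ.filter fun j : Fin n => 3 ≤ (j : ℕ)) = n - 3 := by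
  rw [show (univ.filter fun j : Fin n => 3 ≤ (j : ℕ)) = Finset.Ici ⟨3, by omega⟩ by
    ext; simp [Fin.le_def], Fin.card_Ici]

theorem card_filter_three_le_lt (n : ℕ) (hn : 4 ≤ n) :
    #(univ.filter fun p : Fin n × Fin n => 3 ≤ (p.1 : ℕ) ∧ p.1 < p.2) =
      ∑ j ∈ range n, (j - 3) := by
  rw [Finset.card_filter, Fintype.sum_prod_type_right, ← Fin.sum_univ_eq_sum_range]
  refine Finset.sum_congr rfl fun j _ => ?_
  rw [← Finset.card_filter, show (univ.filter fun k : Fin n => 3 ≤ (k : ℕ) ∧ k < j) =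
    Finset.Ico ⟨3, by omega⟩ j by ext; simp [Fin.le_def], Fin.card_Ico]

theorem baseQ_isHomogeneous (n : ℕ) (hn : 4 ≤ n) :
    (baseQ n hn).IsHomogeneous ((n - 1) * (n - 3)) := by
  have hX (i j : Fin n) : (X i - X j : MvPolynomial (Fin n) ℂ).IsHomogeneous 1 :=
    (isHomogeneous_X ℂ i).sub (isHomogeneous_X ℂ j)
  have h := (IsHomogeneous.prod (univ.filter fun j : Fin n => 3 ≤ (j : ℕ)) _ (fun _ => 1 + 1 + 1)
    fun j _ => ((hX ⟨0, by omega⟩ j).mul (hX ⟨1, by omega⟩ j)).mul (hX ⟨2, by omega⟩ j)).mul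
    (IsHomogeneous.prod
      (univ.filter fun p : Fin n × Fin n => 3 ≤ (p.1 : ℕ) ∧ p.1 < p.2) _ (fun _ => 1 * 2)
      fun p _ => (hX p.1 p.2).pow 2)
  convert h using 1
  · rfl
  rw [Finset.sum_const, Finset.sum_const, card_filter_three_le n hn, card_filter_three_le_lt n hn]
  obtain ⟨m, rfl⟩ := Nat.exists_eq_add_of_le' hn
  have := two_mul_sum_range_sub_three m
  simp only [smul_eq_mul, show m + 4 - 1 = m + 3 by omega, show m + 4 - 3 = m + 1 by omega]
  linarith

theorem Qpoly_isHomogeneous (n : ℕ) (hn : 4 ≤ n) :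
    (Qpoly n hn).IsHomogeneous ((n - 1) * (n - 3)) :=
  IsHomogeneous.sum _ _ _ fun _ _ => (baseQ_isHomogeneous n hn).rename_isHomogeneous

theorem aeval_Qpoly_eq_zero {A : Type*} [CommRing A] [Algebra ℂ A] (n : ℕ) (hn : 4 ≤ n)
    (a : Fin n → A) (h01 : a ⟨0, by omega⟩ = a ⟨1, by omega⟩)
    (h23 : a ⟨2, by omega⟩ = a ⟨3, by omega⟩) : aeval a (Qpoly n hn) = 0 := by
  rw [Qpoly, map_sum]
  refine Finset.sum_eq_zero fun σ _ => ?_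
  by_contra h
  have h0 := symm_apply_lt_three_of_aeval_ne_zero h (by simp) h01.symm
  have h1 := symm_apply_lt_three_of_aeval_ne_zero h (by simp) h01
  have h2 := symm_apply_lt_three_of_aeval_ne_zero h (by simp) h23.symm
  have h3 := symm_apply_lt_three_of_aeval_ne_zero h (by simp) h23
  have hne (i j : Fin n) (hij : i ≠ j) : (σ.symm i : ℕ) ≠ σ.symm j := by
    simpa [Fin.val_inj] using hij
  have := hne ⟨0, by omega⟩ ⟨1, by omega⟩ (by simp)
  have := hne ⟨0, by omega⟩ ⟨2, by omega⟩ (by simp)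
  have := hne ⟨0, by omega⟩ ⟨3, by omega⟩ (by simp)
  have := hne ⟨1, by omega⟩ ⟨2, by omega⟩ (by simp)
  have := hne ⟨1, by omega⟩ ⟨3, by omega⟩ (by simp)
  have := hne ⟨2, by omega⟩ ⟨3, by omega⟩ (by simp)
  omega

/-- The point `(0, 0, 0, -3, -4, …)`, at which `Qpoly` is positive. -/
def witness (n : ℕ) (i : Fin n) : ℝ := if (i : ℕ) < 3 then 0 else -(i : ℕ)

theorem apply_lt_three_of_aeval_witness_ne_zero {n : ℕ} {hn : 4 ≤ n} {σ : Equiv.Perm (Fin n)}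
    (h : aeval (fun i => (witness n i : ℂ)) (rename σ (baseQ n hn)) ≠ 0) {i : Fin n}
    (hi : (i : ℕ) < 3) : (σ i : ℕ) < 3 := by
  have h0 := symm_apply_lt_three_of_aeval_ne_zero h (u := ⟨1, by omega⟩) (v := ⟨0, by omega⟩)
    (by simp) (by simp [witness])
  have h1 := symm_apply_lt_three_of_aeval_ne_zero h (u := ⟨0, by omega⟩) (v := ⟨1, by omega⟩)
    (by simp) (by simp [witness])
  have h2 := symm_apply_lt_three_of_aeval_ne_zero h (u := ⟨0, by omega⟩) (v := ⟨2, by omega⟩)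
    (by simp) (by simp [witness])
  have hne (i j : Fin n) (hij : i ≠ j) : (σ.symm i : ℕ) ≠ σ.symm j := by
    simpa [Fin.val_inj] using hij
  have h01 := hne ⟨0, by omega⟩ ⟨1, by omega⟩ (by simp)
  have h02 := hne ⟨0, by omega⟩ ⟨2, by omega⟩ (by simp)
  have h12 := hne ⟨1, by omega⟩ ⟨2, by omega⟩ (by simp)
  have key : (i : ℕ) = σ.symm ⟨0, by omega⟩ ∨ (i : ℕ) = σ.symm ⟨1, by omega⟩ ∨
      (i : ℕ) = σ.symm ⟨2, by omega⟩ := by omega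
  rcases key with h | h | h <;> rw [Fin.ext h] <;> simp

theorem witness_nonpos (n : ℕ) (i : Fin n) : witness n i ≤ 0 := by
  unfold witness
  split_ifs <;> simp

theorem aeval_witness_nonneg (n : ℕ) (hn : 4 ≤ n) (σ : Equiv.Perm (Fin n)) :
    0 ≤ (aeval (fun i => (witness n i : ℂ)) (rename σ (baseQ n hn))).re := by
  by_cases h : aeval (fun i => (witness n i : ℂ)) (rename σ (baseQ n hn)) = 0
  · simp [h]
  have hσ (i : Fin n) (hi : (i : ℕ) < 3) : witness n (σ i) = 0 :=
    if_pos (apply_lt_three_of_aeval_witness_ne_zero h hi)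
  rw [aeval_rename, aeval_baseQ]
  simp only [Function.comp_apply]
  norm_cast
  rw [hσ ⟨0, _⟩ (by simp), hσ ⟨1, _⟩ (by simp), hσ ⟨2, _⟩ (by simp)]
  refine mul_nonneg (Finset.prod_nonneg fun j _ => ?_) (Finset.prod_nonneg fun p _ => sq_nonneg _)
  have := sub_nonneg.2 (witness_nonpos n (σ j))
  positivity

theorem aeval_witness_pos (n : ℕ) (hn : 4 ≤ n) :
    0 < (aeval (fun i => (witness n i : ℂ)) (baseQ n hn)).re := by
  rw [aeval_baseQ]
  norm_cast
  refine mul_pos (Finset.prod_pos fun j hj => ?_) (Finset.prod_pos fun p hp => ?_)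
  · have hj : 3 ≤ (j : ℕ) := by simpa using hj
    have : (0 : ℝ) < (j : ℕ) := by exact_mod_cast (by omega : 0 < (j : ℕ))
    simp only [witness, if_neg hj.not_gt]
    norm_num
    positivity
  · obtain ⟨h1, h2⟩ : 3 ≤ (p.1 : ℕ) ∧ p.1 < p.2 := by simpa using hp
    have h2' : (p.1 : ℕ) < p.2 := h2
    have h3 : ((p.1 : ℕ) : ℝ) < (p.2 : ℕ) := by exact_mod_cast h2'
    simp only [witness, if_neg h1.not_gt, if_neg (h1.trans h2'.le).not_gt]
    exact pow_pos (by linarith) 2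

theorem Qpoly_ne_zero (n : ℕ) (hn : 4 ≤ n) : Qpoly n hn ≠ 0 := by
  intro h
  have h0 : (aeval (fun i => (witness n i : ℂ)) (Qpoly n hn)).re = 0 := by simp [h]
  rw [Qpoly, map_sum, Complex.re_sum] at h0
  refine (Finset.sum_pos' (fun σ _ => aeval_witness_nonneg n hn σ)
    ⟨1, Finset.mem_univ _, ?_⟩).ne' h0
  simpa using aeval_witness_pos n hn

theorem Qpoly_properties (n : ℕ) (hn : 4 ≤ n) :
    Qpoly n hn ≠ 0 ∧
    (Qpoly n hn).IsSymmetric ∧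
    (Qpoly n hn).IsHomogeneous ((n - 1) * (n - 3)) ∧
    MvPolynomial.aeval (R := ℂ)
      (fun i : Fin n => if (i : ℕ) = 1 then X (⟨0, by omega⟩ : Fin n)
        else if (i : ℕ) = 3 then X (⟨2, by omega⟩ : Fin n)
        else (X i : MvPolynomial (Fin n) ℂ)) (Qpoly n hn) = 0 := by
  exact ⟨Qpoly_ne_zero n hn, Qpoly_isSymmetric n hn, Qpoly_isHomogeneous n hn,
    aeval_Qpoly_eq_zero n hn _ (by simp) (by simp)⟩
end

section
/- For every integer n ≥ 4, the minimal value of |λ| over all admissible partitions λ with n parts equals (n−1)(n−3), and it is attained by the partition λ = (2n−5, 2n−7, ..., 5, 3, 0, 0, 0), i.e. λ_j = 2(n−j)−3 for 1 ≤ j ≤ n−3 and λ_{n−2} = λ_{n−1} = λ_n = 0. -/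
open Finset

/-- A multiset of exponents of the form `{i, i}` (i.e. `e_i²`) or `{i, i+1}` (i.e. `e_i e_{i+1}`). -/
def GoodPair (P : Multiset ℕ) : Prop := ∃ i : ℕ, P = {i, i} ∨ P = {i, i + 1}

/-- Non-admissibility of a partition, via multiset containment of exponent multisets. -/
def NonAdmissible (n : ℕ) (l : ℕ → ℕ) : Prop :=
  (∃ P Q : Multiset ℕ, GoodPair P ∧ GoodPair Q ∧ P + Q ≤ (Finset.range n).val.map l) ∨
  (∃ i : ℕ, ({i, i, i, i + 2} : Multiset ℕ) ≤ (Finset.range n).val.map l)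

def Admissible (n : ℕ) (l : ℕ → ℕ) : Prop := ¬ NonAdmissible n l

theorem map_quadruple_le {n : ℕ} (l : ℕ → ℕ) {p q r t : ℕ} (hp : p < n) (hq : q < n)
    (hr : r < n) (ht : t < n) (hnd : [p, q, r, t].Nodup) :
    ({l p, l q, l r, l t} : Multiset ℕ) ≤ (Finset.range n).val.map l := by
  have h : ((([p, q, r, t] : List ℕ) : Multiset ℕ)) ≤ (Finset.range n).val := by
    rw [Multiset.le_iff_subset (Multiset.coe_nodup.2 hnd)]
    intro x hx
    simp only [Multiset.mem_coe, List.mem_cons, List.not_mem_nil, or_false] at hx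
    simp only [Finset.mem_val, Finset.mem_range]
    omega
  exact Multiset.map_le_map h

theorem goodPair_of_close {x y : ℕ} (hxy : x ≤ y) (hyx : y ≤ x + 1) : GoodPair {x, y} := by
  refine ⟨x, ?_⟩
  obtain rfl | rfl : y = x ∨ y = x + 1 := by omega
  · exact Or.inl rfl
  · exact Or.inr rfl

/-- In an admissible partition, two close pairs of consecutive parts must overlap. -/
theorem Admissible.not_close_close {n : ℕ} {l : ℕ → ℕ} (hl : Antitone l) (h : Admissible n l)
    {p q : ℕ} (hpq : p + 2 ≤ q) (hq : q + 1 < n) (hcp : l p ≤ l (p + 1) + 1) :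
    l (q + 1) + 2 ≤ l q := by
  by_contra! hcq
  refine h (Or.inl ⟨{l (p + 1), l p}, {l (q + 1), l q},
    goodPair_of_close (hl (by omega)) hcp, goodPair_of_close (hl (by omega)) (by omega), ?_⟩)
  exact map_quadruple_le l (p := p + 1) (q := p) (r := q + 1) (t := q) (by omega) (by omega)
    (by omega) (by omega) (by simp; omega)

theorem Admissible.gap_of_triple {n : ℕ} {l : ℕ → ℕ} (hl : Antitone l) (h : Admissible n l)
    {p : ℕ} (hp : p + 3 < n) (h₁ : l (p + 1) = l (p + 3)) (h₂ : l (p + 2) = l (p + 3)) :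
    l (p + 3) + 3 ≤ l p := by
  have hfar : l (p + 1) + 2 ≤ l p := by
    by_contra! hc
    have := h.not_close_close hl (p := p) (q := p + 2) le_rfl (by omega) (by omega)
    simp only [Nat.add_assoc, Nat.reduceAdd] at this
    omega
  by_contra! hc
  have hp2 : l p = l (p + 3) + 2 := by omega
  refine h (Or.inr ⟨l (p + 3), ?_⟩)
  have := map_quadruple_le l (p := p + 1) (q := p + 2) (r := p + 3) (t := p) (n := n) (by omega)
    (by omega) (by omega) (by omega) (by simp)
  rwa [h₁, h₂, hp2] at this

/-- If a sequence of `n` integers starts at a nonnegative value, increases by at least two at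
each step except possibly at two consecutive steps, and jumps by three after three equal values,
then its sum is at least `(n - 1) * (n - 3)`. -/
theorem le_sum_of_gaps {n : ℕ} (hn : 1 ≤ n) (a : ℕ → ℕ)
    (hmono : ∀ k, k + 1 < n → a k ≤ a (k + 1))
    (hclose : ∀ i j, i + 2 ≤ j → j + 1 < n → a (i + 1) ≤ a i + 1 → a j + 2 ≤ a (j + 1))
    (htriple : ∀ i, i + 3 < n → a (i + 1) = a i → a (i + 2) = a i → a i + 3 ≤ a (i + 3)) :
    ((n : ℤ) - 1) * (n - 3) ≤ ∑ k ∈ Finset.range n, (a k : ℤ) := by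
  obtain ⟨i, hbefore, hat⟩ : ∃ i, (∀ k, k < i → k + 1 < n → a k + 2 ≤ a (k + 1)) ∧
      (i + 1 < n → a (i + 1) ≤ a i + 1) := by
    have hex : ∃ i, i + 1 < n → a (i + 1) ≤ a i + 1 := ⟨n, by omega⟩
    classical
    refine ⟨Nat.find hex, fun k hk hkn => ?_, Nat.find_spec hex⟩
    have := Nat.find_min hex hk
    omega
  have hlow : ∀ k, k ≤ i → k < n → 2 * k ≤ a k := by
    intro k
    induction k with
    | zero => simp
    | succ k ih =>
      intro hk hkn
      have := ih (by omega) (by omega)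
      have := hbefore k (by omega) hkn
      omega
  have hhigh : ∀ k, i + 3 + k < n → 2 * (i + k) + 3 ≤ a (i + 3 + k) := by
    intro k
    induction k with
    | zero =>
      intro hk
      have h₀ := hlow i le_rfl (by omega)
      have h₁ := hmono i (by omega)
      have h₂ := hmono (i + 1) (by omega)
      have h₃ := hclose i (i + 2) le_rfl (by omega) (hat (by omega))
      have h₄ := htriple i (by omega)
      simp only [Nat.add_assoc, Nat.reduceAdd, Nat.add_zero] at *
      omega
    | succ k ih =>
      intro hk
      have h₀ := ih (by omega)
      have h₁ := hclose i (i + 3 + k) (by omega) (by omega) (hat (by omega))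
      rw [← Nat.add_assoc (i + 3)]
      omega
  have hsum : ∀ m, m < n → ((m : ℤ) + 1) * (m - 3) + 3 + (if m = i + 1 then 1 else 0) ≤
      ∑ k ∈ Finset.range (m + 1), (a k : ℤ) := by
    intro m
    induction m with
    | zero => simp
    | succ m ih =>
      intro hm
      have hprev := ih (by omega)
      rw [Finset.sum_range_succ]
      have hstep : (2 * m - 1 : ℤ) + (if m + 1 = i + 1 then 1 else 0) ≤
          a (m + 1) + (if m = i + 1 then 1 else 0) := by
        rcases lt_or_ge m i with hmi | hmi
        · have := hlow (m + 1) hmi hm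
          split_ifs <;> omega
        · have h₀ := hlow i le_rfl (by omega)
          have h₁ := hmono i (by omega)
          obtain rfl | rfl | ⟨k, rfl⟩ : m = i ∨ m = i + 1 ∨ ∃ k, m = i + 2 + k := by
            rcases Nat.lt_or_ge m (i + 2) with h | h
            · omega
            · exact Or.inr (Or.inr ⟨m - (i + 2), by omega⟩)
          · split_ifs <;> omega
          · have h₂ := hmono (i + 1) hm
            split_ifs <;> omega
          · have h₂ := hhigh k (by omega)
            rw [show i + 3 + k = i + 2 + k + 1 by omega] at h₂
            split_ifs <;> omega
      have halg : ((m + 1 : ℕ) + 1 : ℤ) * ((m + 1 : ℕ) - 3) = (m + 1) * (m - 3) + (2 * m - 1) := by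
        push_cast
        ring
      rw [halg]
      linarith
  obtain ⟨m, rfl⟩ : ∃ m, n = m + 1 := ⟨n - 1, by omega⟩
  have := hsum m (by omega)
  have hnn : (0 : ℤ) ≤ if m = i + 1 then 1 else 0 := by split_ifs <;> simp
  push_cast
  nlinarith

theorem Admissible.le_sum {n : ℕ} (hn : 4 ≤ n) {l : ℕ → ℕ} (hl : Antitone l)
    (h : Admissible n l) : (n - 1) * (n - 3) ≤ ∑ j ∈ Finset.range n, l j := by
  have key := le_sum_of_gaps (n := n) (by omega) (fun k => l (n - 1 - k))
    (fun k _ => hl (by omega))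
    (fun i j hij hj hc => by
      have := h.not_close_close hl (p := n - 1 - (j + 1)) (q := n - 1 - (i + 1))
        (by omega) (by omega)
      rw [show n - 1 - (j + 1) + 1 = n - 1 - j by omega,
        show n - 1 - (i + 1) + 1 = n - 1 - i by omega] at this
      omega)
    (fun i hi h₁ h₂ => by
      have := h.gap_of_triple hl (p := n - 1 - (i + 3)) (by omega)
      rw [show n - 1 - (i + 3) + 1 = n - 1 - (i + 2) by omega,
        show n - 1 - (i + 3) + 2 = n - 1 - (i + 1) by omega,
        show n - 1 - (i + 3) + 3 = n - 1 - i by omega] at this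
      exact this h₂ h₁)
  rw [Finset.sum_range_reflect (fun j => (l j : ℤ)) n] at key
  zify [show 1 ≤ n by omega, show 3 ≤ n by omega]
  exact key

/-- The partition `(2n-5, 2n-7, …, 5, 3, 0, 0, 0)`. -/
def minimalPartition (n : ℕ) : ℕ → ℕ := fun j => if j + 4 ≤ n then 2 * (n - j) - 5 else 0

theorem partitionN_minimalPartition (n : ℕ) : PartitionN n (minimalPartition n) := by
  refine ⟨fun i j hij => ?_, fun j hj => ?_⟩ <;> simp only [minimalPartition] <;> split_ifs <;> omega

theorem count_zero_minimalPartition_le (n : ℕ) :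
    ((Finset.range n).val.map (minimalPartition n)).count 0 ≤ 3 := by
  rw [Multiset.count_map, ← Finset.filter_val, Finset.card_val]
  refine (Finset.card_le_card (t := {n - 3, n - 2, n - 1}) fun j hj => ?_).trans
    Finset.card_le_three
  rw [Finset.mem_filter, Finset.mem_range, minimalPartition] at hj
  simp only [Finset.mem_insert, Finset.mem_singleton]
  split_ifs at hj <;> omega

theorem count_pos_minimalPartition_le (n : ℕ) {x : ℕ} (hx : x ≠ 0) :
    ((Finset.range n).val.map (minimalPartition n)).count x ≤ 1 := by
  rw [Multiset.count_map, ← Finset.filter_val, Finset.card_val]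
  refine Finset.card_le_one.2 fun i hi j hj => ?_
  rw [Finset.mem_filter, Finset.mem_range, minimalPartition] at hi hj
  split_ifs at hi hj <;> omega

theorem eq_zero_or_odd_of_mem_minimalPartition {n x : ℕ}
    (hx : x ∈ (Finset.range n).val.map (minimalPartition n)) :
    x = 0 ∨ (3 ≤ x ∧ x % 2 = 1) := by
  obtain ⟨j, -, rfl⟩ := Multiset.mem_map.1 hx
  simp only [minimalPartition]
  split_ifs <;> omega

theorem GoodPair.eq_of_le_minimalPartition {n : ℕ} {P : Multiset ℕ} (hP : GoodPair P)
    (hle : P ≤ (Finset.range n).val.map (minimalPartition n)) : P = {0, 0} := by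
  obtain ⟨i, rfl | rfl⟩ := hP
  · by_cases hi : i = 0
    · rw [hi]
    · have h₁ := Multiset.count_le_of_le i hle
      have h₂ := count_pos_minimalPartition_le n hi
      simp [-Finset.range_val] at h₁
      omega
  · have h₁ := eq_zero_or_odd_of_mem_minimalPartition (Multiset.mem_of_le hle (a := i) (by simp))
    have h₂ := eq_zero_or_odd_of_mem_minimalPartition
      (Multiset.mem_of_le hle (a := i + 1) (by simp))
    omega

theorem admissible_minimalPartition (n : ℕ) : Admissible n (minimalPartition n) := by
  rintro (⟨P, Q, hP, hQ, hle⟩ | ⟨i, hle⟩)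
  · obtain rfl := hP.eq_of_le_minimalPartition ((Multiset.le_add_right P Q).trans hle)
    obtain rfl := hQ.eq_of_le_minimalPartition ((Multiset.le_add_left Q _).trans hle)
    have h₁ := Multiset.count_le_of_le 0 hle
    have h₂ := count_zero_minimalPartition_le n
    simp [-Finset.range_val] at h₁
    omega
  · by_cases hi : i = 0
    · have := eq_zero_or_odd_of_mem_minimalPartition
        (Multiset.mem_of_le hle (a := i + 2) (by simp))
      omega
    · have h₁ := Multiset.count_le_of_le i hle
      have h₂ := count_pos_minimalPartition_le n hi
      simp [-Finset.range_val] at h₁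
      omega

theorem sum_minimalPartition {n : ℕ} (hn : 4 ≤ n) :
    ∑ j ∈ Finset.range n, minimalPartition n j = (n - 1) * (n - 3) := by
  induction n, hn using Nat.le_induction with
  | base => decide
  | succ n hn ih =>
    have hshift : ∀ j, minimalPartition (n + 1) (j + 1) = minimalPartition n j := fun j => by
      simp only [minimalPartition]
      split_ifs <;> omega
    rw [Finset.sum_range_succ', Finset.sum_congr rfl fun j _ => hshift j, ih]
    obtain ⟨m, rfl⟩ := Nat.exists_eq_add_of_le' hn
    simp only [minimalPartition]
    rw [if_pos (by omega), show m + 4 - 1 = m + 3 by omega, show m + 4 - 3 = m + 1 by omega,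
      show m + 4 + 1 - 1 = m + 4 by omega, show m + 4 + 1 - 3 = m + 2 by omega,
      show 2 * (m + 4 + 1 - 0) - 5 = 2 * m + 5 by omega]
    ring

/-- The minimal weight of an admissible partition with `n` parts is `(n-1)(n-3)`, attained by
`λ = (2n-5, 2n-7, …, 5, 3, 0, 0, 0)` (0-indexed: `l j = 2(n-j) - 5` for `j ≤ n-4`, else `0`). -/
theorem admissible_minimal_weight (n : ℕ) (hn : 4 ≤ n) :
    let l0 : ℕ → ℕ := fun j => if j + 4 ≤ n then 2 * (n - j) - 5 else 0
    PartitionN n l0 ∧ Admissible n l0 ∧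
    (∑ j ∈ Finset.range n, l0 j) = (n - 1) * (n - 3) ∧
    (∀ l : ℕ → ℕ, PartitionN n l → Admissible n l →
      (n - 1) * (n - 3) ≤ ∑ j ∈ Finset.range n, l j) :=
  ⟨partitionN_minimalPartition n, admissible_minimalPartition n, sum_minimalPartition hn,
    fun _ hl h => h.le_sum hn hl.1⟩
end

section
/- Let n ≥ 2. A symmetric polynomial f ∈ ℂ[x_1,...,x_n] satisfies f(x,x,x_3,...,x_n) = 0 (i.e. substituting x_2 := x_1 yields the zero polynomial) if and only if f = (∏_{1≤i<j≤n} (x_i − x_j))² · k for some symmetric polynomial k ∈ ℂ[x_1,...,x_n]. -/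
open MvPolynomial Finset

namespace MvPolynomial

section Diagonal

variable {σ R : Type*} [DecidableEq σ] [CommRing R]

/-- The polynomial `X i - X j` divides the difference between `p` and the result of
substituting `X i` for `X j` in `p`. -/
theorem X_sub_X_dvd_sub_aeval_update (i j : σ) (p : MvPolynomial σ R) :
    (X i - X j : MvPolynomial σ R) ∣ p - aeval (Function.update X j (X i)) p := by
  induction p using MvPolynomial.induction_on with
  | C a => simp [algebraMap_eq]
  | add p q hp hq =>
    rw [map_add, add_sub_add_comm]
    exact dvd_add hp hq
  | mul_X p k hp =>
    have hk : (X i - X j : MvPolynomial σ R) ∣ X k - Function.update X j (X i) k := by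
      rcases eq_or_ne k j with rfl | hkj
      · rw [Function.update_self, ← neg_sub]
        exact neg_dvd.2 dvd_rfl
      · simp [Function.update_of_ne hkj]
    rw [map_mul, aeval_X]
    exact dvd_mul_sub_mul hp hk

/-- `X i - X j` divides `p` if and only if `p` vanishes after substituting `X i` for `X j`. -/
theorem X_sub_X_dvd_iff {i j : σ} (hij : i ≠ j) {p : MvPolynomial σ R} :
    (X i - X j : MvPolynomial σ R) ∣ p ↔
      aeval (Function.update X j (X i : MvPolynomial σ R)) p = 0 := by
  constructor
  · rintro ⟨q, rfl⟩
    simp [Function.update_of_ne hij]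
  · intro h
    simpa only [h, sub_zero] using X_sub_X_dvd_sub_aeval_update i j p

theorem prime_X_sub_X [IsDomain R] {i j : σ} (hij : i ≠ j) :
    Prime (X i - X j : MvPolynomial σ R) := by
  refine ⟨sub_ne_zero.2 fun h => hij (X_injective h), fun hu => ?_, fun a b hab => ?_⟩
  · have h := (X_sub_X_dvd_iff hij).1 (hu.dvd (a := (1 : MvPolynomial σ R)))
    simp at h
  · simpa only [X_sub_X_dvd_iff hij, map_mul, mul_eq_zero] using hab

theorem X_sub_X_dvd_X_sub_X [Nontrivial R] {i j k l : σ} (hij : i ≠ j) (hkl : k ≠ l)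
    (h : (X i - X j : MvPolynomial σ R) ∣ X k - X l) :
    (k = i ∧ l = j) ∨ (k = j ∧ l = i) := by
  rw [X_sub_X_dvd_iff hij, map_sub, aeval_X, aeval_X, sub_eq_zero] at h
  simp only [Function.update_apply] at h
  split_ifs at h with hk hl hl
  · exact absurd (hk.trans hl.symm) hkl
  · exact Or.inr ⟨hk, (X_injective h).symm⟩
  · exact Or.inl ⟨X_injective h, hl⟩
  · exact absurd (X_injective h) hkl

/-- A symmetric polynomial divisible by `X i - X j` is divisible by its square. -/
theorem IsSymmetric.X_sub_X_sq_dvd [IsDomain R] [NeZero (2 : R)] {f : MvPolynomial σ R}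
    (hf : f.IsSymmetric) {i j : σ} (hij : i ≠ j) (h : (X i - X j : MvPolynomial σ R) ∣ f) :
    (X i - X j : MvPolynomial σ R) ^ 2 ∣ f := by
  obtain ⟨g, rfl⟩ := h
  rw [pow_two]
  refine mul_dvd_mul_left _ ((X_sub_X_dvd_iff hij).2 ?_)
  have hswap : rename (Equiv.swap i j) g = -g := by
    refine mul_left_cancel₀ (prime_X_sub_X (R := R) hij).ne_zero ?_
    have := hf (Equiv.swap i j)
    simp only [map_mul, map_sub, rename_X, Equiv.swap_apply_left, Equiv.swap_apply_right] at this
    linear_combination -this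
  have hcomp : (Function.update X j (X i) : σ → MvPolynomial σ R) ∘ Equiv.swap i j =
      Function.update X j (X i) := by
    funext k
    rcases eq_or_ne k i with rfl | hki
    · simp [Function.update_of_ne hij]
    rcases eq_or_ne k j with rfl | hkj
    · simp [Function.update_of_ne hij]
    · simp [Equiv.swap_apply_of_ne_of_ne hki hkj]
  have hneg := congrArg (aeval (Function.update X j (X i : MvPolynomial σ R))) hswap
  rw [aeval_rename, hcomp, map_neg] at hneg
  have h2 : (2 : MvPolynomial σ R) ≠ 0 := by
    rw [← map_ofNat (MvPolynomial.C : R →+* MvPolynomial σ R) 2]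
    exact C_ne_zero.2 two_ne_zero
  exact (mul_eq_zero.1 (by linear_combination hneg :
    (2 : MvPolynomial σ R) * aeval (Function.update X j (X i)) g = 0)).resolve_left h2

/-- A symmetric polynomial divisible by one difference of variables is divisible by all. -/
theorem IsSymmetric.X_sub_X_dvd_of_dvd {f : MvPolynomial σ R} (hf : f.IsSymmetric)
    {i j k l : σ} (hij : i ≠ j) (hkl : k ≠ l) (h : (X i - X j : MvPolynomial σ R) ∣ f) :
    (X k - X l : MvPolynomial σ R) ∣ f := by
  have hl : Equiv.swap i k j ≠ k := fun h' =>
    hij ((Equiv.swap i k).injective ((Equiv.swap_apply_left i k).trans h'.symm))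
  have := map_dvd (rename ((Equiv.swap i k).trans (Equiv.swap (Equiv.swap i k j) l))) h
  rw [hf] at this
  simpa [Equiv.swap_apply_of_ne_of_ne hl.symm hkl] using this

end Diagonal

section Vandermonde

variable {R : Type*} [CommRing R] {n : ℕ}

theorem prod_X_sub_X_sq_eq_det_vandermonde_sq :
    (∏ p ∈ Finset.univ.filter (fun p : Fin n × Fin n => p.1 < p.2),
      (X p.1 - X p.2 : MvPolynomial (Fin n) R)) ^ 2 =
    (Matrix.vandermonde (X : Fin n → MvPolynomial (Fin n) R)).det ^ 2 := by
  rw [Matrix.det_vandermonde, Finset.prod_filter, Fintype.prod_prod_type, ← Finset.prod_pow,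
    ← Finset.prod_pow]
  refine Finset.prod_congr rfl fun i _ => ?_
  rw [← Finset.prod_filter, ← Finset.prod_pow, ← Finset.prod_pow]
  refine Finset.prod_congr (by ext; simp) fun j _ => ?_
  ring

theorem isSymmetric_prod_X_sub_X_sq :
    ((∏ p ∈ Finset.univ.filter (fun p : Fin n × Fin n => p.1 < p.2),
      (X p.1 - X p.2 : MvPolynomial (Fin n) R)) ^ 2).IsSymmetric := by
  intro e
  have hmap : (rename e).mapMatrix (Matrix.vandermonde (X : Fin n → MvPolynomial (Fin n) R)) =
      (Matrix.vandermonde X).submatrix e id := by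
    ext1 i j
    simp [Matrix.vandermonde_apply]
  rw [prod_X_sub_X_sq_eq_det_vandermonde_sq, map_pow, AlgHom.map_det, hmap, Matrix.det_permute,
    mul_pow]
  rcases Int.units_eq_one_or (Equiv.Perm.sign e) with h | h <;> simp [h]

/-- If a symmetric polynomial is divisible by some difference of variables, then it is divisible
by the square of the Vandermonde product. -/
theorem IsSymmetric.prod_X_sub_X_sq_dvd [IsDomain R] [UniqueFactorizationMonoid R]
    [NeZero (2 : R)] {f : MvPolynomial (Fin n) R} (hf : f.IsSymmetric) {i j : Fin n} (hij : i ≠ j)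
    (h : (X i - X j : MvPolynomial (Fin n) R) ∣ f) :
    (∏ p ∈ Finset.univ.filter (fun p : Fin n × Fin n => p.1 < p.2),
      (X p.1 - X p.2 : MvPolynomial (Fin n) R)) ^ 2 ∣ f := by
  rw [← Finset.prod_pow]
  refine Finset.prod_dvd_of_isRelPrime ?_ ?_
  · intro p hp q hq hpq
    simp only [Finset.coe_filter, Finset.mem_univ, true_and, Set.mem_ofPred_eq] at hp hq
    refine IsRelPrime.pow (((prime_X_sub_X hp.ne).irreducible.isRelPrime_iff_not_dvd).2 ?_)
    intro hdvd
    rcases X_sub_X_dvd_X_sub_X hp.ne hq.ne hdvd with ⟨h1, h2⟩ | ⟨h1, h2⟩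
    · exact hpq (Prod.ext h1.symm h2.symm)
    · exact absurd hq (by rw [h1, h2]; exact hp.asymm)
  · intro p hp
    have hne := (Finset.mem_filter.1 hp).2.ne
    exact hf.X_sub_X_sq_dvd hne (hf.X_sub_X_dvd_of_dvd hij hne h)

end Vandermonde

end MvPolynomial

/-- A symmetric polynomial in `n ≥ 2` variables vanishes under the substitution `x₂ := x₁`
if and only if it is the square of the Vandermonde determinant times a symmetric polynomial. -/
theorem vanish_on_diagonal_iff (n : ℕ) (hn : 2 ≤ n) (f : MvPolynomial (Fin n) ℂ)
    (hf : f.IsSymmetric) :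
    (MvPolynomial.aeval (R := ℂ)
        (fun i : Fin n => if (i : ℕ) = 1 then X (⟨0, by omega⟩ : Fin n)
          else (X i : MvPolynomial (Fin n) ℂ)) f = 0)
    ↔ ∃ k : MvPolynomial (Fin n) ℂ, k.IsSymmetric ∧
        f = (∏ p ∈ Finset.univ.filter (fun p : Fin n × Fin n => p.1 < p.2),
              (X p.1 - X p.2)) ^ 2 * k := by
  have h01 : (⟨0, by omega⟩ : Fin n) ≠ ⟨1, by omega⟩ := by simp
  have hsubst : (fun i : Fin n => if (i : ℕ) = 1 then X (⟨0, by omega⟩ : Fin n)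
      else (X i : MvPolynomial (Fin n) ℂ)) =
      Function.update X ⟨1, by omega⟩ (X ⟨0, by omega⟩) := by
    funext i
    simp [Function.update_apply, Fin.ext_iff]
  rw [hsubst, ← X_sub_X_dvd_iff h01]
  constructor
  · intro h
    obtain ⟨k, hk⟩ := hf.prod_X_sub_X_sq_dvd h01 h
    refine ⟨k, fun e => ?_, hk⟩
    have hV : (∏ p ∈ Finset.univ.filter (fun p : Fin n × Fin n => p.1 < p.2),
        (X p.1 - X p.2 : MvPolynomial (Fin n) ℂ)) ^ 2 ≠ 0 :=
      pow_ne_zero _ (Finset.prod_ne_zero_iff.2 fun p hp =>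
        (prime_X_sub_X (Finset.mem_filter.1 hp).2.ne).ne_zero)
    have he := hf e
    rw [hk, map_mul, isSymmetric_prod_X_sub_X_sq e] at he
    exact mul_left_cancel₀ hV he
  · rintro ⟨k, -, rfl⟩
    refine Dvd.dvd.mul_right (Dvd.dvd.pow ?_ two_ne_zero) k
    exact Finset.dvd_prod_of_mem (fun p : Fin n × Fin n => (X p.1 - X p.2 : MvPolynomial _ ℂ))
      (a := (⟨0, by omega⟩, ⟨1, by omega⟩)) (by simp)
end
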